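/- arXiv:1507.02775 — 2 statements merged into one kernel-verified Lean document; each statement's English description precedes it below -/
import Mathlib

section
/- (Local L⁴ estimate in terms of the bulk energy, equation (4.7) of the paper.) Let Λ ∈ (0,1) and C₁ > 0. There exist constants C > 0 and κ₀ > 0, depending only on Λ and C₁, such that the following holds. Let κ ≥ κ₀ and H satisfy Λκ ≤ H ≤ κ; set b = (1 − κ^{−1/2})H/κ and R = 4√H. Let Ω ⊂ ℝ² be open, let A ∈ C²(Ω; ℝ²) satisfy |∂₁A₂ − ∂₂A₁ − 1| ≤ C₁/κ on Ω, and let ψ ∈ C²(Ω; ℂ) satisfy −(∇ − iκHA)²ψ = κ²(1 − |ψ|²)ψ in Ω and |ψ| ≤ 1 on Ω. Let E < 0 be a real number such that E_blk(v; b, R) ≥ R²E for every v in the Dirichlet class D_R. Then for every square Q ⊂ ℝ² of side-length 2κ^{−1/2} whose center x_c satisfies that the closed disk of center x_c and radius 4κ^{−1/2} is contained in Ω, one has (∫_Q |ψ|⁴ dx)^{1/2} ≤ C κ^{−1/2} (−E)^{1/2} + C κ^{−1}. -/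
open MeasureTheory

noncomputable section

/-- The vector potential `A₀(x₁,x₂) = (−x₂/2, x₁/2)`, generating a unit magnetic field. -/
def A0 (x : ℝ × ℝ) : ℝ × ℝ := (-x.2 / 2, x.1 / 2)

/-- `|(∇−iA₀)u|²`, the squared modulus of the magnetic gradient of `u`. -/
def magGradSq (u : ℝ × ℝ → ℂ) (x : ℝ × ℝ) : ℝ :=
  ‖fderiv ℝ u x (1, 0) - Complex.I * ((A0 x).1 : ℂ) * u x‖ ^ 2 +
  ‖fderiv ℝ u x (0, 1) - Complex.I * ((A0 x).2 : ℂ) * u x‖ ^ 2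

/-- The open square `Q_R = (−R/2,R/2) × (−R/2,R/2)`. -/
def QR (R : ℝ) : Set (ℝ × ℝ) := Set.Ioo (-R / 2) (R / 2) ×ˢ Set.Ioo (-R / 2) (R / 2)

/-- The bulk energy `E_blk(u;b,R) = ∫_{Q_R} (b|(∇−iA₀)u|² − |u|² + ½|u|⁴)`. -/
def Eblk (u : ℝ × ℝ → ℂ) (b R : ℝ) : ℝ :=
  ∫ x in QR R, (b * magGradSq u x - ‖u x‖ ^ 2 + (1 / 2) * ‖u x‖ ^ 4)

/-- The linear energy `E_lin(u;b,R) = ∫_{Q_R} (b|(∇−iA₀)u|² − |u|²)`. -/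
def Elin (u : ℝ × ℝ → ℂ) (b R : ℝ) : ℝ :=
  ∫ x in QR R, (b * magGradSq u x - ‖u x‖ ^ 2)

/-- The Dirichlet class `D_R`: functions `C¹` on the closure of `Q_R` vanishing on `∂Q_R`. -/
def DirichletClass (u : ℝ × ℝ → ℂ) (R : ℝ) : Prop :=
  ContDiffOn ℝ 1 u (closure (QR R)) ∧ ∀ x ∈ frontier (QR R), u x = 0

/-- The Neumann class `N_R`: functions `C¹` on the closure of `Q_R`. -/
def NeumannClass (u : ℝ × ℝ → ℂ) (R : ℝ) : Prop :=
  ContDiffOn ℝ 1 u (closure (QR R))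

/-- The magnetic Laplacian `(∇−iA₀)²u = Δu − 2i A₀·∇u − |A₀|²u` (using `div A₀ = 0`). -/
def magLap (u : ℝ × ℝ → ℂ) (x : ℝ × ℝ) : ℂ :=
  (fderiv ℝ (fun y => fderiv ℝ u y (1, 0)) x (1, 0) +
   fderiv ℝ (fun y => fderiv ℝ u y (0, 1)) x (0, 1))
  - 2 * Complex.I * (((A0 x).1 : ℂ) * fderiv ℝ u x (1, 0) +
                     ((A0 x).2 : ℂ) * fderiv ℝ u x (0, 1))
  - (((A0 x).1 ^ 2 + (A0 x).2 ^ 2 : ℝ) : ℂ) * u x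

/-- The constrained Dirichlet ground-state energy
`m^D(b,R) = inf { E_lin(u;b,R) / (∫_{Q_R}|u|⁴)^{1/2} : u ∈ D_R, u ≠ 0 }`. -/
def mD (b R : ℝ) : ℝ :=
  sInf {m : ℝ | ∃ u : ℝ × ℝ → ℂ, DirichletClass u R ∧ u ≠ 0 ∧
    m = Elin u b R / Real.sqrt (∫ x in QR R, ‖u x‖ ^ 4)}

/-- The constrained Neumann ground-state energy
`m^N(b,R) = inf { E_lin(u;b,R) / (∫_{Q_R}|u|⁴)^{1/2} : u ∈ N_R, u ≠ 0 }`. -/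
def mN (b R : ℝ) : ℝ :=
  sInf {m : ℝ | ∃ u : ℝ × ℝ → ℂ, NeumannClass u R ∧ u ≠ 0 ∧
    m = Elin u b R / Real.sqrt (∫ x in QR R, ‖u x‖ ^ 4)}

/-- The outward unit normal of the square `Q_R` (at non-corner boundary points). -/
def nuSq (R : ℝ) (x : ℝ × ℝ) : ℝ × ℝ :=
  (if x.1 = R / 2 then 1 else if x.1 = -R / 2 then -1 else 0,
   if x.2 = R / 2 then 1 else if x.2 = -R / 2 then -1 else 0)

/-- The corner points of the square `Q_R`. -/
def IsCornerPt (R : ℝ) (x : ℝ × ℝ) : Prop :=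
  (x.1 = R / 2 ∨ x.1 = -R / 2) ∧ (x.2 = R / 2 ∨ x.2 = -R / 2)

/-- The magnetic Neumann boundary condition `ν·(∇−iA₀)u = 0` at non-corner points of `∂Q_R`. -/
def MagNeumannBC (u : ℝ × ℝ → ℂ) (R : ℝ) : Prop :=
  ∀ x ∈ frontier (QR R), ¬ IsCornerPt R x →
    ((nuSq R x).1 : ℂ) * (fderiv ℝ u x (1, 0) - Complex.I * ((A0 x).1 : ℂ) * u x) +
    ((nuSq R x).2 : ℂ) * (fderiv ℝ u x (0, 1) - Complex.I * ((A0 x).2 : ℂ) * u x) = 0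

/-- `|(∇ − icA)u|²`, the squared modulus of the magnetic gradient of `u` with
vector potential `A` and coupling `c` (here `c = κH`). -/
def magGradSqA (c : ℝ) (A : ℝ × ℝ → ℝ × ℝ) (u : ℝ × ℝ → ℂ) (x : ℝ × ℝ) : ℝ :=
  ‖fderiv ℝ u x (1, 0) - Complex.I * (c : ℂ) * ((A x).1 : ℂ) * u x‖ ^ 2 +
  ‖fderiv ℝ u x (0, 1) - Complex.I * (c : ℂ) * ((A x).2 : ℂ) * u x‖ ^ 2

/-- The divergence of a planar vector field. -/
def divA (A : ℝ × ℝ → ℝ × ℝ) (x : ℝ × ℝ) : ℝ :=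
  fderiv ℝ (fun y => (A y).1) x (1, 0) + fderiv ℝ (fun y => (A y).2) x (0, 1)

/-- The curl of a planar vector field, `curl A = ∂₁A₂ − ∂₂A₁`. -/
def curlA (A : ℝ × ℝ → ℝ × ℝ) (x : ℝ × ℝ) : ℝ :=
  fderiv ℝ (fun y => (A y).2) x (1, 0) - fderiv ℝ (fun y => (A y).1) x (0, 1)

/-- The Laplacian of `u : ℝ² → ℂ`. -/
def lap (u : ℝ × ℝ → ℂ) (x : ℝ × ℝ) : ℂ :=
  fderiv ℝ (fun y => fderiv ℝ u y (1, 0)) x (1, 0) +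
  fderiv ℝ (fun y => fderiv ℝ u y (0, 1)) x (0, 1)

/-- The magnetic Laplacian
`(∇ − icA)²u = Δu − 2ic A·∇u − ic(div A)u − c²|A|²u` (here `c = κH`). -/
def magLapA (c : ℝ) (A : ℝ × ℝ → ℝ × ℝ) (u : ℝ × ℝ → ℂ) (x : ℝ × ℝ) : ℂ :=
  lap u x
  - 2 * Complex.I * (c : ℂ) * (((A x).1 : ℂ) * fderiv ℝ u x (1, 0) +
                               ((A x).2 : ℂ) * fderiv ℝ u x (0, 1))
  - Complex.I * (c : ℂ) * (divA A x : ℂ) * u x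
  - ((c ^ 2 * ((A x).1 ^ 2 + (A x).2 ^ 2) : ℝ) : ℂ) * u x

/-- The first Ginzburg–Landau equation `−(∇ − iκHA)²ψ = κ²(1 − |ψ|²)ψ` on `Ω`. -/
def GLequation (κ H : ℝ) (A : ℝ × ℝ → ℝ × ℝ) (ψ : ℝ × ℝ → ℂ) (Ω : Set (ℝ × ℝ)) : Prop :=
  ∀ x ∈ Ω, -magLapA (κ * H) A ψ x = ((κ ^ 2 * (1 - ‖ψ x‖ ^ 2) : ℝ) : ℂ) * ψ x

/-- The closed disk of center `c` and radius `r` (Euclidean). -/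
def closedDisk (c : ℝ × ℝ) (r : ℝ) : Set (ℝ × ℝ) :=
  {x : ℝ × ℝ | (x.1 - c.1) ^ 2 + (x.2 - c.2) ^ 2 ≤ r ^ 2}

/-- The open square of center `c` and half side-length `h`. -/
def openSquare (c : ℝ × ℝ) (h : ℝ) : Set (ℝ × ℝ) :=
  Set.Ioo (c.1 - h) (c.1 + h) ×ˢ Set.Ioo (c.2 - h) (c.2 + h)

/-- Differentiation under the integral sign for a `C¹` integrand over `[0, 1]`. -/
lemma hasFDerivAt_integral_of_contDiff {G : (ℝ × ℝ) × ℝ → ℝ} (hG : ContDiff ℝ 1 G) (x : ℝ × ℝ) :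
    HasFDerivAt (fun x => ∫ t in (0 : ℝ)..1, G (x, t))
      (∫ t in (0 : ℝ)..1, (fderiv ℝ G (x, t)).comp (ContinuousLinearMap.inl ℝ (ℝ × ℝ) ℝ)) x := by
  have hcont : Continuous fun p : (ℝ × ℝ) × ℝ =>
      (fderiv ℝ G p).comp (ContinuousLinearMap.inl ℝ (ℝ × ℝ) ℝ) :=
    (hG.continuous_fderiv one_ne_zero).clm_comp continuous_const
  obtain ⟨B, hB⟩ := ((isCompact_closedBall x 1).prod
    (isCompact_Icc (a := (0 : ℝ)) (b := 1))).exists_bound_of_continuousOn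
    hcont.continuousOn
  refine intervalIntegral.hasFDerivAt_integral_of_dominated_of_fderiv_le (𝕜 := ℝ)
    (F := fun x t => G (x, t)) (bound := fun _ => B)
    (F' := fun x t => (fderiv ℝ G (x, t)).comp (ContinuousLinearMap.inl ℝ (ℝ × ℝ) ℝ))
    (Metric.closedBall_mem_nhds x one_pos) ?_ ?_ ?_ ?_ ?_ ?_
  · exact Filter.Eventually.of_forall fun y =>
      (hG.continuous.comp (by fun_prop : Continuous fun t : ℝ => (y, t))).aestronglyMeasurable
  · exact (hG.continuous.comp (by fun_prop : Continuous fun t : ℝ => (x, t))).intervalIntegrable _ _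
  · exact (hcont.comp (by fun_prop : Continuous fun t : ℝ => (x, t))).aestronglyMeasurable
  · refine Filter.Eventually.of_forall fun t ht y hy => hB (y, t) ⟨hy, ?_⟩
    rw [Set.uIoc_of_le zero_le_one] at ht
    exact ⟨ht.1.le, ht.2⟩
  · exact intervalIntegrable_const
  · refine Filter.Eventually.of_forall fun t _ y _ => ?_
    have h1 := (hG.differentiable one_ne_zero (y, t)).hasFDerivAt
    exact h1.comp y (hasFDerivAt_prodMk_left y t)

lemma contDiff_integral_of_contDiff {G : (ℝ × ℝ) × ℝ → ℝ} (hG : ContDiff ℝ 1 G) :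
    ContDiff ℝ 1 (fun x => ∫ t in (0 : ℝ)..1, G (x, t)) := by
  rw [contDiff_one_iff_fderiv]
  refine ⟨fun x => (hasFDerivAt_integral_of_contDiff hG x).differentiableAt, ?_⟩
  have h : fderiv ℝ (fun x => ∫ t in (0 : ℝ)..1, G (x, t)) = fun x =>
      ∫ t in (0 : ℝ)..1, (fderiv ℝ G (x, t)).comp (ContinuousLinearMap.inl ℝ (ℝ × ℝ) ℝ) :=
    funext fun x => (hasFDerivAt_integral_of_contDiff hG x).fderiv
  rw [h]
  refine intervalIntegral.continuous_parametric_intervalIntegral_of_continuous' ?_ _ _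
  exact (hG.continuous_fderiv one_ne_zero).clm_comp continuous_const

/-- The mean `∫₀¹ t (curl A)(c + t (x - c)) dt` of the curl along the segment from `c` to `x`. -/
def radialCurl (A : ℝ × ℝ → ℝ × ℝ) (c x : ℝ × ℝ) : ℝ :=
  ∫ t in (0 : ℝ)..1, t * curlA A (c + t • (x - c))

/-- The directional derivative of a planar field decomposed along the coordinate directions. -/
lemma fderiv_apply_eq_add {F : Type*} [NormedAddCommGroup F] [NormedSpace ℝ F]
    (L : ℝ × ℝ →L[ℝ] F) (v : ℝ × ℝ) : L v = v.1 • L (1, 0) + v.2 • L (0, 1) := by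
  rw [← map_smul, ← map_smul, ← map_add]
  simp

lemma fderiv_fst_apply {A : ℝ × ℝ → ℝ × ℝ} {x : ℝ × ℝ} (hA : DifferentiableAt ℝ A x)
    (v : ℝ × ℝ) : fderiv ℝ (fun y => (A y).1) x v = (fderiv ℝ A x v).1 := by
  rw [hA.hasFDerivAt.fst.fderiv]; rfl

lemma fderiv_snd_apply {A : ℝ × ℝ → ℝ × ℝ} {x : ℝ × ℝ} (hA : DifferentiableAt ℝ A x)
    (v : ℝ × ℝ) : fderiv ℝ (fun y => (A y).2) x v = (fderiv ℝ A x v).2 := by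
  rw [hA.hasFDerivAt.snd.fderiv]; rfl

/-- The radial (Poincaré) gauge: modulo a gradient, a `C²` field is determined by its curl. -/
lemma exists_radial_gauge {A : ℝ × ℝ → ℝ × ℝ} (hA : ContDiff ℝ 2 A) (c : ℝ × ℝ) :
    ∃ φ : ℝ × ℝ → ℝ, ContDiff ℝ 1 φ ∧ ∀ x v,
      fderiv ℝ φ x v = (A x).1 * v.1 + (A x).2 * v.2
        - ((x - c).1 * v.2 - (x - c).2 * v.1) * radialCurl A c x := by
  have hA1 : ContDiff ℝ 1 A := hA.of_le (by norm_num)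
  have hAd : Differentiable ℝ A := hA1.differentiable one_ne_zero
  have hDA : Continuous (fderiv ℝ A) := hA1.continuous_fderiv one_ne_zero
  set P : (ℝ × ℝ) × ℝ → ℝ × ℝ := fun p => c + p.2 • (p.1 - c) with hP
  have hPc : ContDiff ℝ 1 P := by fun_prop
  set G : (ℝ × ℝ) × ℝ → ℝ := fun p =>
    (A (P p)).1 * (p.1 - c).1 + (A (P p)).2 * (p.1 - c).2 with hG
  have hAP : ContDiff ℝ 1 (fun p => A (P p)) := hA1.comp hPc
  have hGc : ContDiff ℝ 1 G := by fun_prop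
  refine ⟨fun x => ∫ t in (0 : ℝ)..1, G (x, t), contDiff_integral_of_contDiff hGc, fun x v => ?_⟩
  rw [(hasFDerivAt_integral_of_contDiff hGc x).fderiv,
    ContinuousLinearMap.intervalIntegral_apply
      (((hGc.continuous_fderiv one_ne_zero).clm_comp continuous_const).comp
        (by fun_prop : Continuous fun t : ℝ => (x, t))|>.intervalIntegrable _ _)]
  -- the derivative of the integrand in the direction `v`
  have hpt : ∀ t : ℝ, ((fderiv ℝ G (x, t)).comp (ContinuousLinearMap.inl ℝ (ℝ × ℝ) ℝ)) v =
      (A (P (x, t))).1 * v.1 + (A (P (x, t))).2 * v.2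
      + t * ((fderiv ℝ A (P (x, t)) v).1 * (x - c).1 + (fderiv ℝ A (P (x, t)) v).2 * (x - c).2) := by
    intro t
    have e1 : HasFDerivAt (fun y : ℝ × ℝ => c + t • (y - c))
        (t • ContinuousLinearMap.id ℝ (ℝ × ℝ)) x :=
      (((hasFDerivAt_id x).sub_const c).const_smul t).const_add c
    have e2 := (hAd (P (x, t))).hasFDerivAt.comp x e1
    have e3 : HasFDerivAt (fun y : ℝ × ℝ => y - c) (ContinuousLinearMap.id ℝ (ℝ × ℝ)) x :=
      (hasFDerivAt_id x).sub_const c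
    have e4 := (e2.fst.mul e3.fst).add (e2.snd.mul e3.snd)
    have e5 : HasFDerivAt (fun y : ℝ × ℝ => G (y, t))
        ((fderiv ℝ G (x, t)).comp (ContinuousLinearMap.inl ℝ (ℝ × ℝ) ℝ)) x :=
      HasFDerivAt.comp (g := G) x (hGc.differentiable one_ne_zero (x, t)).hasFDerivAt
        (hasFDerivAt_prodMk_left x t)
    rw [e5.unique e4]
    simp [hP]
    ring
  -- the total derivative along the ray
  have hray : ∀ t : ℝ, HasDerivAt (fun t : ℝ => t * ((A (P (x, t))).1 * v.1 + (A (P (x, t))).2 * v.2))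
      ((A (P (x, t))).1 * v.1 + (A (P (x, t))).2 * v.2
      + t * ((fderiv ℝ A (P (x, t)) (x - c)).1 * v.1 + (fderiv ℝ A (P (x, t)) (x - c)).2 * v.2)) t := by
    intro t
    have e1 : HasDerivAt (fun t : ℝ => c + t • (x - c)) ((1 : ℝ) • (x - c)) t :=
      ((hasDerivAt_id t).smul_const (x - c)).const_add c
    have e2 := (hAd (P (x, t))).hasFDerivAt.comp_hasDerivAt t e1
    have f1 := (ContinuousLinearMap.fst ℝ ℝ ℝ).hasFDerivAt.comp_hasDerivAt t e2
    have f2 := (ContinuousLinearMap.snd ℝ ℝ ℝ).hasFDerivAt.comp_hasDerivAt t e2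
    have e3 := (hasDerivAt_id t).mul ((f1.mul_const v.1).add (f2.mul_const v.2))
    refine e3.congr_deriv ?_
    simp [hP]
  have hPt : Continuous fun t : ℝ => P (x, t) := by fun_prop
  have cA : Continuous fun t : ℝ => A (P (x, t)) := hA1.continuous.comp hPt
  have cD : ∀ w, Continuous fun t : ℝ => fderiv ℝ A (P (x, t)) w := fun w =>
    (hDA.comp hPt).clm_apply continuous_const
  have cv := cD v
  have cx := cD (x - c)
  have hftc := intervalIntegral.integral_eq_sub_of_hasDerivAt (a := 0) (b := 1)
    (fun t _ => hray t) (Continuous.intervalIntegrable (by fun_prop) _ _)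
  have hcurl : radialCurl A c x * ((x - c).1 * v.2 - (x - c).2 * v.1) =
      ∫ t in (0 : ℝ)..1, t * ((fderiv ℝ A (P (x, t)) (x - c)).1 * v.1
        + (fderiv ℝ A (P (x, t)) (x - c)).2 * v.2
        - ((fderiv ℝ A (P (x, t)) v).1 * (x - c).1 + (fderiv ℝ A (P (x, t)) v).2 * (x - c).2)) := by
    rw [radialCurl, ← intervalIntegral.integral_mul_const]
    congr 1
    ext t
    rw [curlA, fderiv_fst_apply (hAd _), fderiv_snd_apply (hAd _), fderiv_apply_eq_add _ v,
      fderiv_apply_eq_add _ (x - c)]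
    simp [hP]
    ring
  have hx : P (x, 1) = x := by simp [hP]
  simp only [hpt]
  simp only [hx, one_mul, zero_mul, sub_zero] at hftc
  rw [mul_comm _ (radialCurl A c x), hcurl, ← hftc,
    ← intervalIntegral.integral_sub (Continuous.intervalIntegrable (by fun_prop) _ _)
      (Continuous.intervalIntegrable (by fun_prop) _ _)]
  congr 1
  ext t
  ring

lemma abs_radialCurl_sub_half_le {A : ℝ × ℝ → ℝ × ℝ} (hA : ContDiff ℝ 2 A) {c x : ℝ × ℝ} {ε : ℝ}
    (h : ∀ t ∈ Set.Ioc (0 : ℝ) 1, |curlA A (c + t • (x - c)) - 1| ≤ ε) :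
    |radialCurl A c x - 1 / 2| ≤ ε := by
  have hA1 : ContDiff ℝ 1 A := hA.of_le (by norm_num)
  have hP : Continuous fun t : ℝ => c + t • (x - c) := by fun_prop
  have hcurl : Continuous fun t : ℝ => curlA A (c + t • (x - c)) := by
    have hd : ∀ w, Continuous fun t : ℝ => fderiv ℝ A (c + t • (x - c)) w := fun w =>
      ((hA1.continuous_fderiv one_ne_zero).comp hP).clm_apply continuous_const
    have h1 := hd (1, 0)
    have h2 := hd (0, 1)
    simp only [curlA, fderiv_fst_apply (hA1.differentiable one_ne_zero _),
      fderiv_snd_apply (hA1.differentiable one_ne_zero _)]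
    fun_prop
  have hhalf : (1 / 2 : ℝ) = ∫ t in (0 : ℝ)..1, t := by norm_num
  rw [radialCurl, hhalf, ← intervalIntegral.integral_sub
    (Continuous.intervalIntegrable (by fun_prop) _ _)
    (Continuous.intervalIntegrable (by fun_prop) _ _)]
  have := intervalIntegral.norm_integral_le_of_norm_le_const (a := (0 : ℝ)) (b := 1) (C := ε)
    (f := fun t => t * curlA A (c + t • (x - c)) - t) ?_
  · simpa using this
  · intro t ht
    rw [Set.uIoc_of_le zero_le_one] at ht
    have h1 := h t ht
    rw [show t * curlA A (c + t • (x - c)) - t = t * (curlA A (c + t • (x - c)) - 1) by ring,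
      norm_mul, Real.norm_eq_abs, Real.norm_eq_abs, abs_of_pos ht.1]
    exact (mul_le_of_le_one_left (abs_nonneg _) ht.2).trans h1

lemma integral_fderiv_apply_eq_zero {F : ℝ × ℝ → ℝ} (hF : ContDiff ℝ 1 F)
    (hc : HasCompactSupport F) (v : ℝ × ℝ) : ∫ x, fderiv ℝ F x v = 0 := by
  have hi : Integrable (fun x => fderiv ℝ F x v) :=
    ((hF.continuous_fderiv one_ne_zero).clm_apply continuous_const).integrable_of_hasCompactSupport
      (hc.fderiv_apply ℝ v)
  have h := integral_mul_fderiv_eq_neg_fderiv_mul_of_integrable (μ := (volume : Measure (ℝ × ℝ)))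
    (𝕜 := ℝ) (f := fun _ : ℝ × ℝ => (1 : ℝ)) (g := F) (v := v) (by simp)
    (by simpa using hi) (by simpa using hF.continuous.integrable_of_hasCompactSupport hc)
    (fun _ _ => differentiableAt_const _) (fun x _ => hF.differentiable one_ne_zero x)
  simpa using h

/-- The component in the direction `v` of the localized flux `χ² Re (ψ̄ ∇ψ)`. -/
def flux (χ : ℝ × ℝ → ℝ) (ψ : ℝ × ℝ → ℂ) (v x : ℝ × ℝ) : ℝ :=
  χ x ^ 2 * ((ψ x).re * (fderiv ℝ ψ x v).re + (ψ x).im * (fderiv ℝ ψ x v).im)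

lemma contDiff_flux {χ : ℝ × ℝ → ℝ} {ψ : ℝ × ℝ → ℂ} (hχ : ContDiff ℝ 1 χ) (hψ : ContDiff ℝ 2 ψ)
    (v : ℝ × ℝ) : ContDiff ℝ 1 (flux χ ψ v) := by
  have hψ1 : ContDiff ℝ 1 ψ := hψ.of_le (by norm_num)
  have hd : ContDiff ℝ 1 (fun x => fderiv ℝ ψ x v) :=
    (hψ.fderiv_right (m := 1) (by norm_num)).clm_apply contDiff_const
  have hre : ∀ {g : ℝ × ℝ → ℂ}, ContDiff ℝ 1 g → ContDiff ℝ 1 (fun x => (g x).re) := fun hg =>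
    Complex.reCLM.contDiff.comp hg
  have him : ∀ {g : ℝ × ℝ → ℂ}, ContDiff ℝ 1 g → ContDiff ℝ 1 (fun x => (g x).im) := fun hg =>
    Complex.imCLM.contDiff.comp hg
  exact (hχ.pow 2).mul (((hre hψ1).mul (hre hd)).add ((him hψ1).mul (him hd)))

lemma fderiv_flux {χ : ℝ × ℝ → ℝ} {ψ : ℝ × ℝ → ℂ} (hχ : ContDiff ℝ 1 χ) (hψ : ContDiff ℝ 2 ψ)
    (v x : ℝ × ℝ) :
    fderiv ℝ (flux χ ψ v) x v =
      2 * χ x * fderiv ℝ χ x v *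
        ((ψ x).re * (fderiv ℝ ψ x v).re + (ψ x).im * (fderiv ℝ ψ x v).im)
      + χ x ^ 2 * (‖fderiv ℝ ψ x v‖ ^ 2
        + ((ψ x).re * (fderiv ℝ (fun y => fderiv ℝ ψ y v) x v).re
          + (ψ x).im * (fderiv ℝ (fun y => fderiv ℝ ψ y v) x v).im)) := by
  have hψ1 : ContDiff ℝ 1 ψ := hψ.of_le (by norm_num)
  have hd : ContDiff ℝ 1 (fun x => fderiv ℝ ψ x v) :=
    (hψ.fderiv_right (m := 1) (by norm_num)).clm_apply contDiff_const
  have e1 := (hχ.differentiable one_ne_zero x).hasFDerivAt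
  have e2 := (hψ1.differentiable one_ne_zero x).hasFDerivAt
  have e3 := (hd.differentiable one_ne_zero x).hasFDerivAt
  have r2 := Complex.reCLM.hasFDerivAt.comp x e2
  have i2 := Complex.imCLM.hasFDerivAt.comp x e2
  have r3 := Complex.reCLM.hasFDerivAt.comp x e3
  have i3 := Complex.imCLM.hasFDerivAt.comp x e3
  have h : HasFDerivAt (flux χ ψ v) _ x := (e1.pow 2).mul ((r2.mul r3).add (i2.mul i3))
  rw [h.fderiv, Complex.sq_norm, Complex.normSq_apply]
  simp
  ring

/-- The pointwise form of the localization identity for a solution of the first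
Ginzburg–Landau equation. -/
lemma localization_identity {p d₁ d₂ L₁ L₂ : ℂ} {χ χ₁ χ₂ c a₁ a₂ dv k : ℝ}
    (h : -(L₁ + L₂ - 2 * Complex.I * (c : ℂ) * ((a₁ : ℂ) * d₁ + (a₂ : ℂ) * d₂)
      - Complex.I * (c : ℂ) * (dv : ℂ) * p - ((c ^ 2 * (a₁ ^ 2 + a₂ ^ 2) : ℝ) : ℂ) * p) =
      ((k ^ 2 * (1 - ‖p‖ ^ 2) : ℝ) : ℂ) * p) :
    ‖(χ₁ * p + χ * d₁) - Complex.I * c * a₁ * (χ * p)‖ ^ 2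
      + ‖(χ₂ * p + χ * d₂) - Complex.I * c * a₂ * (χ * p)‖ ^ 2 =
    (2 * χ * χ₁ * (p.re * d₁.re + p.im * d₁.im)
        + χ ^ 2 * (‖d₁‖ ^ 2 + (p.re * L₁.re + p.im * L₁.im)))
      + (2 * χ * χ₂ * (p.re * d₂.re + p.im * d₂.im)
        + χ ^ 2 * (‖d₂‖ ^ 2 + (p.re * L₂.re + p.im * L₂.im)))
      + (χ₁ ^ 2 + χ₂ ^ 2) * ‖p‖ ^ 2 + k ^ 2 * χ ^ 2 * (1 - ‖p‖ ^ 2) * ‖p‖ ^ 2 := by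
  have hre := congrArg Complex.re h
  have him := congrArg Complex.im h
  simp only [Complex.sq_norm, Complex.normSq_apply] at hre him ⊢
  simp [-Complex.ofReal_pow] at hre him
  simp
  linear_combination χ ^ 2 * (p.re * hre + p.im * him)

lemma one_sub_mul_norm_add_sq_le {δ : ℝ} (h0 : 0 < δ) (h1 : δ ≤ 1) (z w : ℂ) :
    (1 - δ) * ‖z + w‖ ^ 2 ≤ ‖z‖ ^ 2 + δ⁻¹ * ‖w‖ ^ 2 := by
  have h2 : ‖z + w‖ ^ 2 ≤ (‖z‖ + ‖w‖) ^ 2 := by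
    gcongr
    exact norm_add_le z w
  have h3 : (1 - δ) * (‖z‖ + ‖w‖) ^ 2 ≤ ‖z‖ ^ 2 + δ⁻¹ * ‖w‖ ^ 2 := by
    have h4 : δ * ((1 - δ) * (‖z‖ + ‖w‖) ^ 2) ≤ δ * (‖z‖ ^ 2 + δ⁻¹ * ‖w‖ ^ 2) := by
      rw [mul_add, mul_inv_cancel_left₀ h0.ne']
      nlinarith [sq_nonneg (δ * ‖z‖ - (1 - δ) * ‖w‖), mul_nonneg h0.le (sq_nonneg ‖w‖)]
    exact le_of_mul_le_mul_left h4 h0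
  exact (mul_le_mul_of_nonneg_left h2 (by linarith)).trans h3

/-- Pointwise upper bound of the localized energy density after a change of gauge. -/
lemma energy_density_le {p d₁ d₂ L₁ L₂ : ℂ}
    {χ χ₁ χ₂ H a₁ a₂ e₁ e₂ dv s M C₁ : ℝ}
    (h : -(L₁ + L₂ - 2 * Complex.I * ((s ^ 2 * H : ℝ) : ℂ) * ((a₁ : ℂ) * d₁ + (a₂ : ℂ) * d₂)
      - Complex.I * ((s ^ 2 * H : ℝ) : ℂ) * (dv : ℂ) * p
      - (((s ^ 2 * H) ^ 2 * (a₁ ^ 2 + a₂ ^ 2) : ℝ) : ℂ) * p) =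
      (((s ^ 2) ^ 2 * (1 - ‖p‖ ^ 2) : ℝ) : ℂ) * p)
    (hs : 1 ≤ s) (hH0 : 0 < H) (hH : H ≤ s ^ 2) (hp : ‖p‖ ≤ 1) (hχ0 : 0 ≤ χ) (hχ1 : χ ≤ 1)
    (h₁ : |χ₁| ≤ M * s) (h₂ : |χ₂| ≤ M * s)
    (he₁ : |e₁| ≤ 2 * C₁ / s ^ 3) (he₂ : |e₂| ≤ 2 * C₁ / s ^ 3) :
    (1 - s⁻¹) * (‖(χ₁ * p + χ * d₁) - Complex.I * ((s ^ 2 * H : ℝ) : ℂ) * (a₁ - e₁ : ℝ) * (χ * p)‖ ^ 2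
      + ‖(χ₂ * p + χ * d₂) - Complex.I * ((s ^ 2 * H : ℝ) : ℂ) * (a₂ - e₂ : ℝ) * (χ * p)‖ ^ 2)
      - (s ^ 2) ^ 2 * (χ * ‖p‖) ^ 2 + (s ^ 2) ^ 2 * ((1 / 2) * (χ * ‖p‖) ^ 4) ≤
    (2 * χ * χ₁ * (p.re * d₁.re + p.im * d₁.im)
        + χ ^ 2 * (‖d₁‖ ^ 2 + (p.re * L₁.re + p.im * L₁.im)))
      + (2 * χ * χ₂ * (p.re * d₂.re + p.im * d₂.im)
        + χ ^ 2 * (‖d₂‖ ^ 2 + (p.re * L₂.re + p.im * L₂.im)))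
      + (2 * M ^ 2 + 64 * C₁ ^ 4) * s ^ 2 - (s ^ 2) ^ 2 / 4 * (χ ^ 2 * ‖p‖ ^ 4) := by
  have hs0 : 0 < s := by linarith
  have hid := localization_identity (χ := χ) (χ₁ := χ₁) (χ₂ := χ₂) h
  have young : ∀ (d : ℂ) (g a e : ℝ), |e| ≤ 2 * C₁ / s ^ 3 →
      (1 - s⁻¹) * ‖(g * p + χ * d) - Complex.I * ((s ^ 2 * H : ℝ) : ℂ) * (a - e : ℝ) * (χ * p)‖ ^ 2
        ≤ ‖(g * p + χ * d) - Complex.I * ((s ^ 2 * H : ℝ) : ℂ) * a * (χ * p)‖ ^ 2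
          + 4 * C₁ ^ 2 * s ^ 3 * (χ ^ 2 * ‖p‖ ^ 2) := by
    intro d g a e he
    have h3 := one_sub_mul_norm_add_sq_le (inv_pos.2 hs0) (inv_le_one_of_one_le₀ hs)
      ((g * p + χ * d) - Complex.I * ((s ^ 2 * H : ℝ) : ℂ) * a * (χ * p))
      (Complex.I * ((s ^ 2 * H : ℝ) : ℂ) * e * (χ * p))
    have h4 : (g * p + χ * d) - Complex.I * ((s ^ 2 * H : ℝ) : ℂ) * a * (χ * p)
        + Complex.I * ((s ^ 2 * H : ℝ) : ℂ) * e * (χ * p) =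
        (g * p + χ * d) - Complex.I * ((s ^ 2 * H : ℝ) : ℂ) * (a - e : ℝ) * (χ * p) := by
      push_cast; ring
    rw [h4, inv_inv] at h3
    refine h3.trans (add_le_add_right ?_ _)
    have h5 : ‖Complex.I * ((s ^ 2 * H : ℝ) : ℂ) * e * (χ * p)‖ ^ 2
        = (s ^ 2 * H) ^ 2 * e ^ 2 * (χ ^ 2 * ‖p‖ ^ 2) := by
      simp only [norm_mul, Complex.norm_I, Complex.norm_real, Real.norm_eq_abs, mul_pow, sq_abs]
      ring
    have h6 : e ^ 2 ≤ (2 * C₁ / s ^ 3) ^ 2 := by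
      rw [← sq_abs e]; gcongr
    have h7 : s * ((s ^ 2 * H) ^ 2 * e ^ 2) ≤ s * ((s ^ 2 * s ^ 2) ^ 2 * (2 * C₁ / s ^ 3) ^ 2) := by
      gcongr
    have h8 : s * ((s ^ 2 * s ^ 2) ^ 2 * (2 * C₁ / s ^ 3) ^ 2) = 4 * C₁ ^ 2 * s ^ 3 := by
      field_simp; ring
    rw [h5, ← mul_assoc]
    exact mul_le_mul_of_nonneg_right (h7.trans_eq h8) (by positivity)
  have y₁ := young d₁ χ₁ a₁ e₁ he₁
  have y₂ := young d₂ χ₂ a₂ e₂ he₂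
  have grad : ∀ g : ℝ, |g| ≤ M * s → g ^ 2 * ‖p‖ ^ 2 ≤ M ^ 2 * s ^ 2 := by
    intro g hg
    have h3 : g ^ 2 ≤ (M * s) ^ 2 := by rw [← sq_abs g]; gcongr
    have h4 : ‖p‖ ^ 2 ≤ 1 := pow_le_one₀ (norm_nonneg _) hp
    nlinarith [sq_nonneg g, norm_nonneg p]
  have g₁ := grad χ₁ h₁
  have g₂ := grad χ₂ h₂
  set q := ‖p‖ ^ 2 with hq
  have hq4 : ‖p‖ ^ 4 = q ^ 2 := by rw [hq]; ring
  have hχq4 : (χ * ‖p‖) ^ 4 = χ ^ 4 * q ^ 2 := by rw [hq]; ring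
  have hχq2 : (χ * ‖p‖) ^ 2 = χ ^ 2 * q := by rw [hq]; ring
  rw [hq4, hχq4, hχq2]
  have hχ2 : χ ^ 2 ≤ 1 := pow_le_one₀ hχ0 hχ1
  have hχ4 : (s ^ 2) ^ 2 * (χ ^ 4 * q ^ 2) ≤ (s ^ 2) ^ 2 * (χ ^ 2 * q ^ 2) := by
    gcongr (s ^ 2) ^ 2 * (?_ * q ^ 2)
    nlinarith [sq_nonneg χ]
  have absorb : 8 * C₁ ^ 2 * s ^ 3 * (χ ^ 2 * q) ≤
      (s ^ 2) ^ 2 / 4 * (χ ^ 2 * q ^ 2) + 64 * C₁ ^ 4 * s ^ 2 := by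
    have h3 : 0 ≤ χ ^ 2 * (s ^ 2 * q / 2 - 8 * C₁ ^ 2 * s) ^ 2 := by positivity
    have h4 : χ ^ 2 * (64 * C₁ ^ 4 * s ^ 2) ≤ 1 * (64 * C₁ ^ 4 * s ^ 2) := by gcongr
    have h5 : χ ^ 2 * (s ^ 2 * q / 2 - 8 * C₁ ^ 2 * s) ^ 2 = (s ^ 2) ^ 2 / 4 * (χ ^ 2 * q ^ 2)
        - 8 * C₁ ^ 2 * s ^ 3 * (χ ^ 2 * q) + χ ^ 2 * (64 * C₁ ^ 4 * s ^ 2) := by ring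
    linarith
  linarith

/-- Rescaling of a planar square onto a centered square. -/
lemma setIntegral_QR_comp {m r : ℝ} (hm : 0 < m) (c : ℝ × ℝ) (J : ℝ × ℝ → ℝ) :
    ∫ y in QR (2 * (m * r)), J (c + m⁻¹ • y) = m ^ 2 * ∫ x in openSquare c r, J x := by
  have hQ : MeasurableSet (QR (2 * (m * r))) := measurableSet_Ioo.prod measurableSet_Ioo
  have hS : MeasurableSet (openSquare c r) := measurableSet_Ioo.prod measurableSet_Ioo
  have hmem : ∀ y, c + m⁻¹ • y ∈ openSquare c r ↔ y ∈ QR (2 * (m * r)) := by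
    intro y
    simp only [openSquare, QR, Set.mem_prod, Set.mem_Ioo, Prod.fst_add, Prod.snd_add,
      Prod.smul_fst, Prod.smul_snd, smul_eq_mul, add_lt_add_iff_left, sub_lt_iff_lt_add]
    have h1 : ∀ a : ℝ, m⁻¹ * a < r ↔ a < 2 * (m * r) / 2 := fun a => by
      rw [inv_mul_lt_iff₀ hm]; constructor <;> intro h <;> linarith
    have h2 : ∀ a b : ℝ, b < b + m⁻¹ * a + r ↔ -(2 * (m * r)) / 2 < a := fun a b => by
      have := h1 (-a)
      constructor
      · intro h
        have := this.1 (by linarith)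
        linarith
      · intro h
        have := this.2 (by linarith)
        linarith
    simp only [h1, h2]
  rw [← integral_indicator hQ, ← integral_indicator hS]
  have h1 : ∀ y, (QR (2 * (m * r))).indicator (fun y => J (c + m⁻¹ • y)) y =
      (fun x => (openSquare c r).indicator J (c + x)) (m⁻¹ • y) := by
    intro y
    by_cases hy : y ∈ QR (2 * (m * r))
    · simp [hy, (hmem y).2 hy]
    · simp [hy, mt (hmem y).1 hy]
  rw [integral_congr_ae (Filter.Eventually.of_forall h1),
    Measure.integral_comp_inv_smul_of_nonneg volume
      (fun x => (openSquare c r).indicator J (c + x)) hm.le, integral_add_left_eq_self]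
  simp

lemma openSquare_eq_ball (c : ℝ × ℝ) (r : ℝ) : openSquare c r = Metric.ball c r := by
  rw [openSquare, ← Real.ball_eq_Ioo, ← Real.ball_eq_Ioo, ball_prod_same]

/-- The localized and gauge-transformed function `e^{-icφ} χ ψ`. -/
def gaugedLocalization (c : ℝ) (φ χ : ℝ × ℝ → ℝ) (ψ : ℝ × ℝ → ℂ) (x : ℝ × ℝ) : ℂ :=
  Complex.exp (-(Complex.I * c * φ x)) * (χ x * ψ x)

lemma norm_exp_neg_I_mul (a b : ℝ) : ‖Complex.exp (-(Complex.I * a * b))‖ = 1 := by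
  rw [Complex.norm_exp]; simp

lemma norm_gaugedLocalization (c : ℝ) (φ : ℝ × ℝ → ℝ) {χ : ℝ × ℝ → ℝ} (ψ : ℝ × ℝ → ℂ) {x : ℝ × ℝ}
    (hχ : 0 ≤ χ x) : ‖gaugedLocalization c φ χ ψ x‖ = χ x * ‖ψ x‖ := by
  rw [gaugedLocalization, norm_mul, norm_exp_neg_I_mul, one_mul, norm_mul, Complex.norm_real,
    Real.norm_of_nonneg hχ]

lemma contDiff_gaugedLocalization (c : ℝ) {φ χ : ℝ × ℝ → ℝ} {ψ : ℝ × ℝ → ℂ} (hφ : ContDiff ℝ 1 φ)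
    (hχ : ContDiff ℝ 1 χ) (hψ : ContDiff ℝ 1 ψ) : ContDiff ℝ 1 (gaugedLocalization c φ χ ψ) := by
  have h1 : ContDiff ℝ 1 (fun x => (φ x : ℂ)) := Complex.ofRealCLM.contDiff.comp hφ
  have h2 : ContDiff ℝ 1 (fun x => (χ x : ℂ)) := Complex.ofRealCLM.contDiff.comp hχ
  exact ((contDiff_const.mul h1).neg.cexp).mul (h2.mul hψ)

lemma fderiv_gaugedLocalization (c : ℝ) {φ χ : ℝ × ℝ → ℝ} {ψ : ℝ × ℝ → ℂ} (hφ : ContDiff ℝ 1 φ)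
    (hχ : ContDiff ℝ 1 χ) (hψ : ContDiff ℝ 1 ψ) (x w : ℝ × ℝ) :
    fderiv ℝ (gaugedLocalization c φ χ ψ) x w = Complex.exp (-(Complex.I * c * φ x)) *
      ((fderiv ℝ χ x w * ψ x + χ x * fderiv ℝ ψ x w)
        - Complex.I * c * (fderiv ℝ φ x w) * (χ x * ψ x)) := by
  have e1 := Complex.ofRealCLM.hasFDerivAt.comp x (hφ.differentiable one_ne_zero x).hasFDerivAt
  have e2 := Complex.ofRealCLM.hasFDerivAt.comp x (hχ.differentiable one_ne_zero x).hasFDerivAt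
  have e3 := (hψ.differentiable one_ne_zero x).hasFDerivAt
  have h : HasFDerivAt (gaugedLocalization c φ χ ψ) _ x :=
    ((e1.const_mul (Complex.I * c)).neg.cexp).mul (e2.mul e3)
  rw [h.fderiv]
  simp
  ring

lemma fderiv_comp_add_smul {g : ℝ × ℝ → ℂ} (hg : Differentiable ℝ g) (c : ℝ × ℝ) (k : ℝ)
    (y w : ℝ × ℝ) : fderiv ℝ (fun y => g (c + k • y)) y w = k * fderiv ℝ g (c + k • y) w := by
  have e1 : HasFDerivAt (fun y : ℝ × ℝ => c + k • y) (k • ContinuousLinearMap.id ℝ (ℝ × ℝ)) y :=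
    ((hasFDerivAt_id y).const_smul k).const_add c
  have e2 : HasFDerivAt (fun y => g (c + k • y)) _ y := (hg (c + k • y)).hasFDerivAt.comp y e1
  rw [e2.fderiv]
  simp

lemma magGradSq_gaugedLocalization {m : ℝ} (hm : 0 < m) {φ χ : ℝ × ℝ → ℝ} {ψ : ℝ × ℝ → ℂ}
    (hφ : ContDiff ℝ 1 φ) (hχ : ContDiff ℝ 1 χ) (hψ : ContDiff ℝ 1 ψ) (c x y : ℝ × ℝ)
    (hx : x = c + m⁻¹ • y) :
    magGradSq (fun y => gaugedLocalization (m ^ 2) φ χ ψ (c + m⁻¹ • y)) y = (m ^ 2)⁻¹ *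
      (‖(fderiv ℝ χ x (1, 0) * ψ x + χ x * fderiv ℝ ψ x (1, 0))
        - Complex.I * (m ^ 2 : ℝ) * (fderiv ℝ φ x (1, 0) - (x - c).2 / 2 : ℝ) * (χ x * ψ x)‖ ^ 2
      + ‖(fderiv ℝ χ x (0, 1) * ψ x + χ x * fderiv ℝ ψ x (0, 1))
        - Complex.I * (m ^ 2 : ℝ) * (fderiv ℝ φ x (0, 1) + (x - c).1 / 2 : ℝ) * (χ x * ψ x)‖ ^ 2) := by
  have hmC : (m : ℂ) ≠ 0 := by exact_mod_cast hm.ne'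
  have hd := (contDiff_gaugedLocalization (m ^ 2) hφ hχ hψ).differentiable one_ne_zero
  have hy1 : y.1 = m * (x - c).1 := by
    rw [hx]; simp [mul_inv_cancel_left₀ hm.ne']
  have hy2 : y.2 = m * (x - c).2 := by
    rw [hx]; simp [mul_inv_cancel_left₀ hm.ne']
  have key : ∀ (g z e : ℂ) (a b : ℝ), ‖e‖ = 1 →
      ‖((m⁻¹ : ℝ) : ℂ) * (e * (g - Complex.I * (m ^ 2 : ℝ) * a * z))
        - Complex.I * ((m * b : ℝ) : ℂ) * (e * z)‖ ^ 2 =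
      (m ^ 2)⁻¹ * ‖g - Complex.I * (m ^ 2 : ℝ) * (a + b : ℝ) * z‖ ^ 2 := by
    intro g z e a b he
    have : ((m⁻¹ : ℝ) : ℂ) * (e * (g - Complex.I * (m ^ 2 : ℝ) * a * z))
        - Complex.I * ((m * b : ℝ) : ℂ) * (e * z) =
        ((m⁻¹ : ℝ) : ℂ) * e * (g - Complex.I * (m ^ 2 : ℝ) * (a + b : ℝ) * z) := by
      push_cast
      field_simp
      ring
    rw [this, norm_mul, norm_mul, he, Complex.norm_real, mul_one, mul_pow, Real.norm_eq_abs, sq_abs,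
      inv_pow]
  rw [magGradSq, fderiv_comp_add_smul hd, fderiv_comp_add_smul hd, ← hx,
    fderiv_gaugedLocalization _ hφ hχ hψ, fderiv_gaugedLocalization _ hφ hχ hψ, mul_add]
  simp only [A0, hy1, hy2, gaugedLocalization]
  rw [show -(m * (x - c).2) / 2 = m * (-((x - c).2 / 2)) by ring,
    show m * (x - c).1 / 2 = m * ((x - c).1 / 2) by ring, key _ _ _ _ _ (norm_exp_neg_I_mul _ _),
    key _ _ _ _ _ (norm_exp_neg_I_mul _ _)]
  simp only [sub_eq_add_neg]

lemma continuous_magGradSq {u : ℝ × ℝ → ℂ} (hu : ContDiff ℝ 1 u) : Continuous (magGradSq u) := by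
  have h1 : ∀ w, Continuous fun x => fderiv ℝ u x w := fun w =>
    (hu.continuous_fderiv one_ne_zero).clm_apply continuous_const
  have h2 := h1 (1, 0)
  have h3 := h1 (0, 1)
  have h4 := hu.continuous
  unfold magGradSq A0
  fun_prop

lemma integrableOn_openSquare {g : ℝ × ℝ → ℝ} (hg : Continuous g) (c : ℝ × ℝ) (r : ℝ) :
    IntegrableOn g (openSquare c r) := by
  rw [openSquare_eq_ball]
  exact (hg.continuousOn.integrableOn_compact (isCompact_closedBall c r)).mono_set
    Metric.ball_subset_closedBall

lemma QR_eq_openSquare (R : ℝ) : QR R = openSquare 0 (R / 2) := by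
  simp [QR, openSquare, neg_div]

lemma volume_openSquare (c : ℝ × ℝ) {r : ℝ} (hr : 0 ≤ r) :
    volume.real (openSquare c r) = 4 * r ^ 2 := by
  rw [openSquare, Measure.volume_eq_prod, measureReal_def, Measure.prod_prod, Real.volume_Ioo,
    Real.volume_Ioo, ENNReal.toReal_mul, ENNReal.toReal_ofReal (by linarith),
    ENNReal.toReal_ofReal (by linarith)]
  ring

/-- The local estimate for globally defined data, with `κ = s²`. The profile `f` of the cut-off
function equals `1` on the unit square and is supported inside the square of half side `2`. -/
lemma setIntegral_norm_pow_four_le {f : ℝ × ℝ → ℝ} {M : ℝ} (hf : ContDiff ℝ 1 f)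
    (hf0 : ∀ z, 0 ≤ f z) (hf1 : ∀ z, f z ≤ 1) (hfin : ∀ z ∈ Metric.ball (0 : ℝ × ℝ) 1, f z = 1)
    (hfout : tsupport f ⊆ Metric.ball 0 2) (hM : ∀ z, ‖fderiv ℝ f z‖ ≤ M)
    {s H C₁ E : ℝ} (hs : 1 ≤ s) (hH0 : 0 < H) (hH : H ≤ s ^ 2)
    {A : ℝ × ℝ → ℝ × ℝ} {ψ : ℝ × ℝ → ℂ} (hA : ContDiff ℝ 2 A) (hψ : ContDiff ℝ 2 ψ) {c : ℝ × ℝ}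
    (hcurl : ∀ x ∈ openSquare c (2 * s⁻¹), |curlA A x - 1| ≤ C₁ / s ^ 2)
    (hGL : GLequation (s ^ 2) H A ψ (openSquare c (2 * s⁻¹)))
    (hψ1 : ∀ x ∈ openSquare c (2 * s⁻¹), ‖ψ x‖ ≤ 1)
    (hE : ∀ v : ℝ × ℝ → ℂ, DirichletClass v (4 * √H) →
      Eblk v ((1 - s⁻¹) * H / s ^ 2) (4 * √H) ≥ (4 * √H) ^ 2 * E) :
    ∫ x in openSquare c s⁻¹, ‖ψ x‖ ^ 4 ≤
      64 / s ^ 4 * ((2 * M ^ 2 + 64 * C₁ ^ 4) + s ^ 2 * (-E)) := by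
  have hs0 : 0 < s := by linarith
  have hψc1 : ContDiff ℝ 1 ψ := hψ.of_le (by norm_num)
  set K := 2 * M ^ 2 + 64 * C₁ ^ 4 with hK
  set S := openSquare c (2 * s⁻¹) with hS
  have hSball : S = Metric.ball c (2 * s⁻¹) := openSquare_eq_ball c _
  -- the cut-off function
  set χ : ℝ × ℝ → ℝ := fun x => f (s • (x - c)) with hχ
  have hχc : ContDiff ℝ 1 χ := by fun_prop
  have hχd : ∀ x w : ℝ × ℝ, ‖w‖ ≤ 1 → |fderiv ℝ χ x w| ≤ M * s := by
    intro x w hw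
    have e1 : HasFDerivAt (fun x : ℝ × ℝ => s • (x - c)) (s • ContinuousLinearMap.id ℝ (ℝ × ℝ)) x :=
      ((hasFDerivAt_id x).sub_const c).const_smul s
    have e2 : HasFDerivAt χ _ x :=
      (hf.differentiable one_ne_zero (s • (x - c))).hasFDerivAt.comp x e1
    rw [e2.fderiv]
    simp only [ContinuousLinearMap.comp_apply, smul_apply,
      ContinuousLinearMap.id_apply, map_smul, smul_eq_mul, abs_mul, abs_of_pos hs0]
    have e3 : |fderiv ℝ f (s • (x - c)) w| ≤ M * 1 :=
      (ContinuousLinearMap.le_opNorm _ _).trans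
        (mul_le_mul (hM _) hw (norm_nonneg _) ((norm_nonneg _).trans (hM 0)))
    nlinarith
  have hscale : ∀ (x : ℝ × ℝ) (r : ℝ),
      s • (x - c) ∈ Metric.ball (0 : ℝ × ℝ) r ↔ x ∈ Metric.ball c (r * s⁻¹) := by
    intro x r
    rw [mem_ball_zero_iff, norm_smul, Real.norm_of_nonneg hs0.le, mem_ball_iff_norm,
      ← div_eq_mul_inv, lt_div_iff₀ hs0, mul_comm]
  have hχsupp : tsupport χ ⊆ S := by
    refine (tsupport_comp_subset_preimage f (f := fun x => s • (x - c)) (by fun_prop)).trans ?_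
    intro x hx
    rw [hSball, ← hscale]
    exact hfout hx
  have hχzero : ∀ x, x ∉ S → χ x = 0 := fun x hx =>
    image_eq_zero_of_notMem_tsupport fun h => hx (hχsupp h)
  -- the divergence part integrates to zero
  have hdiv : ∀ w : ℝ × ℝ, ∫ x in S, fderiv ℝ (flux χ ψ w) x w = 0 := by
    intro w
    have hts : tsupport (flux χ ψ w) ⊆ tsupport χ :=
      closure_mono fun x hx hx0 => hx (by simp [flux, hx0])
    rw [setIntegral_eq_integral_of_forall_compl_eq_zero]
    · refine integral_fderiv_apply_eq_zero (contDiff_flux hχc hψ w) ?_ w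
      refine HasCompactSupport.intro (isCompact_closedBall c (2 * s⁻¹)) fun x hx => ?_
      have : x ∉ S := fun h => hx (Metric.ball_subset_closedBall (hSball ▸ h))
      simp [flux, hχzero x this]
    · intro x hx
      have : fderiv ℝ (flux χ ψ w) x = 0 := by
        by_contra h
        exact hx (hχsupp (hts (support_fderiv_subset ℝ h)))
      simp [this]
  -- the trial function
  obtain ⟨φ, hφ, hφd⟩ := exists_radial_gauge hA c
  set m := s * √H with hm
  have hm0 : 0 < m := by positivity
  have hm2 : m ^ 2 = s ^ 2 * H := by rw [hm, mul_pow, Real.sq_sqrt hH0.le]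
  set v : ℝ × ℝ → ℂ := fun y => gaugedLocalization (m ^ 2) φ χ ψ (c + m⁻¹ • y) with hv
  have hvc : ContDiff ℝ 1 v := (contDiff_gaugedLocalization (m ^ 2) hφ hχc hψc1).comp (by fun_prop)
  have hR : 4 * √H = 2 * (m * (2 * s⁻¹)) := by rw [hm]; field_simp; norm_num
  have hQS : ∀ y, c + m⁻¹ • y ∈ S ↔ y ∈ QR (4 * √H) := by
    intro y
    rw [hSball, hR, QR_eq_openSquare, openSquare_eq_ball, mem_ball_iff_norm, add_sub_cancel_left,
      norm_smul, Real.norm_of_nonneg (inv_nonneg.2 hm0.le), mem_ball_zero_iff, inv_mul_lt_iff₀ hm0,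
      mul_div_cancel_left₀ _ two_ne_zero]
  have hQopen : IsOpen (QR (4 * √H)) := isOpen_Ioo.prod isOpen_Ioo
  have hvD : DirichletClass v (4 * √H) := by
    refine ⟨hvc.contDiffOn, fun y hy => ?_⟩
    rw [hQopen.frontier_eq] at hy
    simp [hv, gaugedLocalization, hχzero _ (mt (hQS y).1 hy.2)]
  have hEv := hE v hvD
  -- the pointwise bound of the energy density
  set J : ℝ × ℝ → ℝ := fun x => fderiv ℝ (flux χ ψ (1, 0)) x (1, 0)
    + fderiv ℝ (flux χ ψ (0, 1)) x (0, 1) + K * s ^ 2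
    - (s ^ 2) ^ 2 / 4 * (χ x ^ 2 * ‖ψ x‖ ^ 4) with hJ
  have hpt : ∀ y ∈ QR (4 * √H), (1 - s⁻¹) * H / s ^ 2 * magGradSq v y - ‖v y‖ ^ 2
      + (1 / 2) * ‖v y‖ ^ 4 ≤ (s ^ 4)⁻¹ * J (c + m⁻¹ • y) := by
    intro y hy
    obtain ⟨x, hx⟩ : ∃ x, x = c + m⁻¹ • y := ⟨_, rfl⟩
    have hxS : x ∈ S := hx ▸ (hQS y).2 hy
    have hxn : ‖x - c‖ ≤ 2 * s⁻¹ := by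
      rw [hSball, mem_ball_iff_norm] at hxS
      exact hxS.le
    have hI : |radialCurl A c x - 1 / 2| ≤ C₁ / s ^ 2 := by
      refine abs_radialCurl_sub_half_le hA fun t ht => hcurl _ ?_
      rw [hSball, mem_ball_iff_norm, add_sub_cancel_left, norm_smul,
        Real.norm_of_nonneg ht.1.le]
      rw [hSball, mem_ball_iff_norm] at hxS
      exact (mul_le_of_le_one_left (norm_nonneg _) ht.2).trans_lt hxS
    have herr : ∀ a : ℝ, |a| ≤ ‖x - c‖ → |a * (radialCurl A c x - 1 / 2)| ≤ 2 * C₁ / s ^ 3 := by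
      intro a ha
      rw [abs_mul]
      calc |a| * |radialCurl A c x - 1 / 2| ≤ (2 * s⁻¹) * (C₁ / s ^ 2) :=
            mul_le_mul (ha.trans hxn) hI (abs_nonneg _) (by positivity)
        _ = 2 * C₁ / s ^ 3 := by field_simp
    have hden := energy_density_le (χ := χ x) (χ₁ := fderiv ℝ χ x (1, 0))
      (χ₂ := fderiv ℝ χ x (0, 1)) (M := M) (C₁ := C₁)
      (e₁ := -(x - c).2 * (radialCurl A c x - 1 / 2)) (e₂ := (x - c).1 * (radialCurl A c x - 1 / 2))
      (hGL x hxS) hs hH0 hH (hψ1 x hxS) (hf0 _) (hf1 _) (hχd x _ (by simp [Prod.norm_def]))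
      (hχd x _ (by simp [Prod.norm_def])) (herr _ (by rw [abs_neg]; exact norm_snd_le (x - c)))
      (herr _ (norm_fst_le (x - c)))
    rw [← fderiv_flux hχc hψ, ← fderiv_flux hχc hψ] at hden
    have hφ1 : fderiv ℝ φ x (1, 0) - (x - c).2 / 2
        = (A x).1 - -(x - c).2 * (radialCurl A c x - 1 / 2) := by rw [hφd]; ring
    have hφ2 : fderiv ℝ φ x (0, 1) + (x - c).1 / 2
        = (A x).2 - (x - c).1 * (radialCurl A c x - 1 / 2) := by rw [hφd]; ring
    rw [hv, magGradSq_gaugedLocalization hm0 hφ hχc hψc1 c x y hx, hφ1, hφ2]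
    simp only [← hx]
    rw [norm_gaugedLocalization _ φ (χ := χ) ψ (hf0 _), hm2]
    refine le_of_mul_le_mul_left ?_ (by positivity : 0 < s ^ 4)
    rw [mul_inv_cancel_left₀ (by positivity)]
    refine le_trans (le_of_eq ?_) hden
    field_simp
  have hFc : ∀ w : ℝ × ℝ, Continuous fun x => fderiv ℝ (flux χ ψ w) x w := fun w =>
    ((contDiff_flux hχc hψ w).continuous_fderiv one_ne_zero).clm_apply continuous_const
  have hF1 := hFc (1, 0)
  have hF2 := hFc (0, 1)
  have hψcont := hψ.continuous
  have hχcont := hχc.continuous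
  have hvcont := hvc.continuous
  have hvm := continuous_magGradSq hvc
  have hJc : Continuous J := by fun_prop
  have hup : Eblk v ((1 - s⁻¹) * H / s ^ 2) (4 * √H) ≤ (s ^ 4)⁻¹ * (m ^ 2 * ∫ x in S, J x) := by
    rw [← setIntegral_QR_comp hm0, ← hR, ← integral_const_mul]
    refine setIntegral_mono_on ?_ ?_ hQopen.measurableSet hpt
    · rw [QR_eq_openSquare]
      exact integrableOn_openSquare (by fun_prop) _ _
    · rw [QR_eq_openSquare]
      exact integrableOn_openSquare (by fun_prop) _ _
  have hJint : ∫ x in S, J x = 16 * K - (s ^ 2) ^ 2 / 4 * ∫ x in S, χ x ^ 2 * ‖ψ x‖ ^ 4 := by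
    have hi : ∀ {g : ℝ × ℝ → ℝ}, Continuous g → IntegrableOn g S := fun hg =>
      integrableOn_openSquare hg c (2 * s⁻¹)
    simp only [hJ]
    rw [integral_sub (hi (by fun_prop)) (hi (by fun_prop)),
      integral_add (hi (by fun_prop)) (hi (by fun_prop)), integral_add (hi hF1) (hi hF2),
      hdiv, hdiv, integral_const_mul ((s ^ 2) ^ 2 / 4), setIntegral_const,
      volume_openSquare c (by positivity), smul_eq_mul]
    field_simp
    ring
  have hmono : ∫ x in openSquare c s⁻¹, ‖ψ x‖ ^ 4 ≤ ∫ x in S, χ x ^ 2 * ‖ψ x‖ ^ 4 := by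
    have hsub : openSquare c s⁻¹ ⊆ S := by
      rw [hSball, openSquare_eq_ball]
      exact Metric.ball_subset_ball (by linarith [inv_pos.2 hs0])
    have hQm : MeasurableSet (openSquare c s⁻¹) := measurableSet_Ioo.prod measurableSet_Ioo
    rw [setIntegral_congr_fun (g := fun x => χ x ^ 2 * ‖ψ x‖ ^ 4) hQm]
    · refine setIntegral_mono_set (integrableOn_openSquare (by fun_prop) c _) ?_
        (Filter.Eventually.of_forall hsub)
      exact Filter.Eventually.of_forall fun x => by positivity
    · intro x hx
      rw [openSquare_eq_ball] at hx
      have : χ x = 1 := hfin _ ((hscale x 1).2 (by rwa [one_mul]))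
      simp [this]
  rw [hJint, hm2] at hup
  rw [mul_pow, Real.sq_sqrt hH0.le] at hEv
  set T := ∫ x in S, χ x ^ 2 * ‖ψ x‖ ^ 4
  refine hmono.trans ?_
  have h1 : 4 ^ 2 * H * E ≤ (s ^ 4)⁻¹ * (s ^ 2 * H * (16 * K - (s ^ 2) ^ 2 / 4 * T)) :=
    hEv.le.trans hup
  have h2 : (s ^ 4)⁻¹ * (s ^ 2 * H * (16 * K - (s ^ 2) ^ 2 / 4 * T)) =
      H * ((s ^ 2)⁻¹ * (16 * K - (s ^ 2) ^ 2 / 4 * T)) := by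
    field_simp
  have h3 : 16 * E ≤ (s ^ 2)⁻¹ * (16 * K - (s ^ 2) ^ 2 / 4 * T) := by
    refine le_of_mul_le_mul_left ?_ hH0
    linarith
  rw [le_inv_mul_iff₀ (by positivity)] at h3
  rw [div_mul_eq_mul_div, le_div_iff₀ (by positivity)]
  nlinarith

/-- A function of class `C²` on an open set extends globally from a closed ball inside that set. -/
lemma exists_contDiff_extension {F : Type*} [NormedAddCommGroup F] [NormedSpace ℝ F]
    {g : ℝ × ℝ → F} {Ω : Set (ℝ × ℝ)} (hΩ : IsOpen Ω) (hg : ContDiffOn ℝ 2 g Ω) {c : ℝ × ℝ}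
    {r r' : ℝ} (hr : 0 < r) (hrr' : r < r') (hsub : Metric.closedBall c r' ⊆ Ω) :
    ∃ g' : ℝ × ℝ → F, ContDiff ℝ 2 g' ∧ Set.EqOn g' g (Metric.ball c r) := by
  let η : ContDiffBump c := ⟨r, r', hr, hrr'⟩
  refine ⟨fun x => η x • g x, ?_, fun x hx => ?_⟩
  · rw [contDiff_iff_contDiffAt]
    intro x
    by_cases hx : x ∈ Ω
    · exact η.contDiff.contDiffAt.smul (hg.contDiffAt (hΩ.mem_nhds hx))
    · have h : (fun x => η x • g x) =ᶠ[nhds x] fun _ => 0 := by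
        filter_upwards [Metric.isClosed_closedBall.isOpen_compl.mem_nhds
          (fun h => hx (hsub h) : x ∈ (Metric.closedBall c r')ᶜ)] with z hz
        have : r' ≤ dist z c := by
          simp only [Set.mem_compl_iff, Metric.mem_closedBall, not_le] at hz
          exact hz.le
        rw [η.zero_of_le_dist this, zero_smul]
      exact contDiffAt_const.congr_of_eventuallyEq h
  · simp only
    rw [η.one_of_mem_closedBall (Metric.ball_subset_closedBall hx), one_smul]

lemma curlA_congr {A A' : ℝ × ℝ → ℝ × ℝ} {x : ℝ × ℝ} (h : A' =ᶠ[nhds x] A) :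
    curlA A' x = curlA A x := by
  have h1 : (fun y => (A' y).1) =ᶠ[nhds x] fun y => (A y).1 := h.fun_comp Prod.fst
  have h2 : (fun y => (A' y).2) =ᶠ[nhds x] fun y => (A y).2 := h.fun_comp Prod.snd
  rw [curlA, curlA, h1.fderiv_eq, h2.fderiv_eq]

lemma magLapA_congr (k : ℝ) {A A' : ℝ × ℝ → ℝ × ℝ} {u u' : ℝ × ℝ → ℂ} {x : ℝ × ℝ}
    (hA : A' =ᶠ[nhds x] A) (hu : u' =ᶠ[nhds x] u) : magLapA k A' u' x = magLapA k A u x := by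
  have hA1 : (fun y => (A' y).1) =ᶠ[nhds x] fun y => (A y).1 := hA.fun_comp Prod.fst
  have hA2 : (fun y => (A' y).2) =ᶠ[nhds x] fun y => (A y).2 := hA.fun_comp Prod.snd
  have hu2 : ∀ v, (fun y => fderiv ℝ u' y v) =ᶠ[nhds x] fun y => fderiv ℝ u y v := fun v =>
    hu.fderiv.fun_comp fun L => L v
  rw [magLapA, magLapA, lap, lap, divA, divA, hA1.fderiv_eq, hA2.fderiv_eq,
    (hu2 _).fderiv_eq, (hu2 _).fderiv_eq, hu.fderiv_eq, hA.eq_of_nhds, hu.eq_of_nhds]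

/-- Local `L⁴` estimate in terms of the bulk energy (equation (4.7) of the paper):
for a critical point `ψ` of the Ginzburg–Landau functional with the a priori bounds
`|ψ| ≤ 1`, `|curl A − 1| ≤ C₁/κ`, and with `b = (1 − κ^{−1/2})H/κ`, `R = 4√H`,
if `E < 0` bounds the Dirichlet bulk energy from below, then on every square `Q`
of side-length `2κ^{−1/2}` well inside `Ω`,
`(∫_Q |ψ|⁴)^{1/2} ≤ Cκ^{−1/2}(−E)^{1/2} + Cκ^{−1}`. -/
theorem local_L4_estimate (Λ C₁ : ℝ) (hΛ0 : 0 < Λ) (hΛ1 : Λ < 1) (hC₁ : 0 < C₁) :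
    ∃ C : ℝ, 0 < C ∧ ∃ κ₀ : ℝ, 0 < κ₀ ∧
    ∀ (κ H : ℝ) (Ω : Set (ℝ × ℝ)) (A : ℝ × ℝ → ℝ × ℝ) (ψ : ℝ × ℝ → ℂ) (E : ℝ),
      κ₀ ≤ κ → Λ * κ ≤ H → H ≤ κ → IsOpen Ω →
      ContDiffOn ℝ 2 A Ω →
      (∀ x ∈ Ω, |curlA A x - 1| ≤ C₁ / κ) →
      ContDiffOn ℝ 2 ψ Ω →
      GLequation κ H A ψ Ω →
      (∀ x ∈ Ω, ‖ψ x‖ ≤ 1) →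
      E < 0 →
      (∀ v : ℝ × ℝ → ℂ, DirichletClass v (4 * Real.sqrt H) →
        Eblk v ((1 - (Real.sqrt κ)⁻¹) * H / κ) (4 * Real.sqrt H)
          ≥ (4 * Real.sqrt H) ^ 2 * E) →
      ∀ xc : ℝ × ℝ, closedDisk xc (4 * (Real.sqrt κ)⁻¹) ⊆ Ω →
        Real.sqrt (∫ x in openSquare xc (Real.sqrt κ)⁻¹, ‖ψ x‖ ^ 4)
          ≤ C * (Real.sqrt κ)⁻¹ * Real.sqrt (-E) + C * κ⁻¹ := by
  obtain ⟨M, hM⟩ : ∃ M, ∀ z : ℝ × ℝ,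
      ‖fderiv ℝ (⟨1, 3 / 2, one_pos, by norm_num⟩ : ContDiffBump (0 : ℝ × ℝ)) z‖ ≤ M := by
    set f : ContDiffBump (0 : ℝ × ℝ) := ⟨1, 3 / 2, one_pos, by norm_num⟩
    have hfc := (f.contDiff (n := 1)).continuous_fderiv one_ne_zero
    obtain ⟨M, hM⟩ := hfc.bounded_above_of_compact_support (f.hasCompactSupport.fderiv (𝕜 := ℝ))
    exact ⟨M, hM⟩
  set f : ContDiffBump (0 : ℝ × ℝ) := ⟨1, 3 / 2, one_pos, by norm_num⟩ with hf
  set K := 2 * M ^ 2 + 64 * C₁ ^ 4 with hK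
  have hK0 : 0 < K := by positivity
  refine ⟨8 * (√K + 1), by positivity, 1, one_pos, ?_⟩
  intro κ H Ω A ψ E hκ hΛH hHκ hΩ hA hcurl hψ hGL hψ1 hE0 hE c hdisk
  have hκ0 : 0 < κ := by linarith
  have hH0 : 0 < H := lt_of_lt_of_le (by positivity) hΛH
  obtain ⟨s, hs⟩ : ∃ s, s = √κ := ⟨_, rfl⟩
  have hs1 : 1 ≤ s := hs ▸ Real.one_le_sqrt.2 hκ
  have hs0 : 0 < s := by linarith
  have hκs : κ = s ^ 2 := by rw [hs, Real.sq_sqrt hκ0.le]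
  rw [← hs] at hdisk hE ⊢
  rw [hκs] at hHκ hcurl hGL hE ⊢
  have hi : 0 < s⁻¹ := inv_pos.2 hs0
  have hball : Metric.closedBall c (5 / 2 * s⁻¹) ⊆ Ω := by
    refine fun x hx => hdisk ?_
    rw [mem_closedBall_iff_norm] at hx
    have h1 := abs_le.1 ((norm_fst_le (x - c)).trans hx)
    have h2 := abs_le.1 ((norm_snd_le (x - c)).trans hx)
    simp only [Prod.fst_sub, Prod.snd_sub] at h1 h2
    have h3 := sq_le_sq' h1.1 h1.2
    have h4 := sq_le_sq' h2.1 h2.2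
    simp only [closedDisk, Set.mem_ofPred_eq]
    nlinarith [sq_nonneg s⁻¹]
  obtain ⟨A', hA', hAA'⟩ := exists_contDiff_extension hΩ hA (c := c) (r := 2 * s⁻¹)
    (r' := 5 / 2 * s⁻¹) (by positivity) (by linarith) hball
  obtain ⟨ψ', hψ', hψψ'⟩ := exists_contDiff_extension hΩ hψ (c := c) (r := 2 * s⁻¹)
    (r' := 5 / 2 * s⁻¹) (by positivity) (by linarith) hball
  rw [← openSquare_eq_ball] at hAA' hψψ'
  have hSΩ : openSquare c (2 * s⁻¹) ⊆ Ω := by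
    rw [openSquare_eq_ball]
    exact (Metric.ball_subset_closedBall.trans
      (Metric.closedBall_subset_closedBall (by linarith))).trans hball
  have hSopen : IsOpen (openSquare c (2 * s⁻¹)) := isOpen_Ioo.prod isOpen_Ioo
  have hAe : ∀ x ∈ openSquare c (2 * s⁻¹), A' =ᶠ[nhds x] A := fun x hx =>
    hAA'.eventuallyEq_of_mem (hSopen.mem_nhds hx)
  have hψe : ∀ x ∈ openSquare c (2 * s⁻¹), ψ' =ᶠ[nhds x] ψ := fun x hx =>
    hψψ'.eventuallyEq_of_mem (hSopen.mem_nhds hx)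
  have hmain := setIntegral_norm_pow_four_le (f := f) (M := M) (c := c) (A := A') (ψ := ψ') f.contDiff
    (fun _ => f.nonneg) (fun _ => f.le_one)
    (fun z hz => f.one_of_mem_closedBall (Metric.ball_subset_closedBall hz))
    (by rw [f.tsupport_eq]; exact Metric.closedBall_subset_ball (by norm_num [hf])) hM hs1 hH0 hHκ
    hA' hψ' (fun x hx => by rw [curlA_congr (hAe x hx)]; exact hcurl x (hSΩ hx))
    (fun x hx => by
      rw [magLapA_congr _ (hAe x hx) (hψe x hx), hψψ' hx]; exact hGL x (hSΩ hx))
    (fun x hx => by rw [hψψ' hx]; exact hψ1 x (hSΩ hx)) hE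
  have hcongr : ∫ x in openSquare c s⁻¹, ‖ψ x‖ ^ 4 = ∫ x in openSquare c s⁻¹, ‖ψ' x‖ ^ 4 := by
    refine setIntegral_congr_fun (measurableSet_Ioo.prod measurableSet_Ioo) fun x hx => ?_
    have hx' : x ∈ openSquare c (2 * s⁻¹) := by
      rw [openSquare_eq_ball] at hx ⊢
      exact Metric.ball_subset_ball (by linarith) hx
    simp only [hψψ' hx']
  rw [hcongr]
  refine Real.sqrt_le_iff.2 ⟨by positivity, hmain.trans ?_⟩
  have hk := Real.sq_sqrt hK0.le
  have he := Real.sq_sqrt (neg_pos.2 hE0).le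
  have hk0 := Real.sqrt_nonneg K
  have he0 := Real.sqrt_nonneg (-E)
  set k := √K
  set e := √(-E)
  have h1 : 8 * (k + 1) * s⁻¹ * e + 8 * (k + 1) * (s ^ 2)⁻¹ =
      8 / s ^ 2 * ((k + 1) * (s * e) + (k + 1)) := by
    field_simp
  have h2 : (8 / s ^ 2) ^ 2 = 64 / s ^ 4 := by
    field_simp; norm_num
  rw [h1, mul_pow, h2, ← hK, ← hk, ← he]
  gcongr
  have h3 : 0 ≤ s * e := by positivity
  nlinarith [mul_nonneg hk0 h3, mul_nonneg hk0 (sq_nonneg (s * e)),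
    mul_nonneg (sq_nonneg k) (sq_nonneg (s * e)), mul_nonneg (sq_nonneg (k + 1)) h3]
end
end

section
/- (Theorem 4.1: Almog's L⁴-bound in two dimensions.) Let Λ ∈ (0,1) and C₁, C₂ > 0. There exist constants C > 0 and κ₀ > 0, depending only on Λ, C₁ and C₂, such that the following holds. Let κ ≥ κ₀ and H satisfy Λκ ≤ H ≤ κ; set b = (1 − κ^{−1/2})H/κ and R = 4√H. Let Ω ⊂ ℝ² be open, let A ∈ C²(Ω; ℝ²) satisfy |∂₁A₂ − ∂₂A₁ − 1| ≤ C₁/κ on Ω, and let ψ ∈ C²(Ω; ℂ) satisfy −(∇ − iκHA)²ψ = κ²(1 − |ψ|²)ψ in Ω and |ψ| ≤ 1 on Ω. Let E be a real number with E < 0, E_blk(v; b, R) ≥ R²E for every v in the Dirichlet class D_R, and |E| ≤ C₂(1 − b)². Then for every square Q ⊂ ℝ² of side-length 2κ^{−1/2} whose center x_c satisfies that the closed disk of center x_c and radius 4κ^{−1/2} is contained in Ω, one has (1/|Q|) ∫_Q |ψ|⁴ dx ≤ C/κ + C(H/κ − 1)², where |Q| = 4/κ is the area of Q. -/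
open MeasureTheory

noncomputable section

open Filter Topology
open scoped Pointwise

/-- A `C^n` function on a neighbourhood of a closed set `K` agrees near `K` with a globally
`C^n` function. -/
lemma exists_contDiff_eventuallyEq_of_contDiffOn {F : Type*} [NormedAddCommGroup F]
    [NormedSpace ℝ F] {n : ℕ} {Ω K : Set (ℝ × ℝ)} {f : ℝ × ℝ → F} (hΩ : IsOpen Ω)
    (hK : IsClosed K) (hKΩ : K ⊆ Ω) (hf : ContDiffOn ℝ n f Ω) :
    ∃ g : ℝ × ℝ → F, ContDiff ℝ n g ∧ ∀ x ∈ K, g =ᶠ[𝓝 x] f := by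
  obtain ⟨θ, h0, h1, -⟩ := exists_contMDiffMap_zero_one_nhds_of_isClosed
    (modelWithCornersSelf ℝ (ℝ × ℝ)) (n := n) hΩ.isClosed_compl hK
    (Set.disjoint_compl_left_iff_subset.2 hKΩ)
  have hθ : ContDiff ℝ n θ := θ.contMDiff.contDiff
  refine ⟨fun x => θ x • f x, ?_, fun x hx => ?_⟩
  · rw [contDiff_iff_contDiffAt]
    intro x
    by_cases hx : x ∈ Ω
    · exact hθ.contDiffAt.smul (hf.contDiffAt (hΩ.mem_nhds hx))
    · have : (fun y => θ y • f y) =ᶠ[𝓝 x] fun _ => 0 := by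
        filter_upwards [h0.filter_mono (nhds_le_nhdsSet hx)] with y hy
        simp [hy]
      exact contDiffAt_const.congr_of_eventuallyEq this
  · filter_upwards [h1.filter_mono (nhds_le_nhdsSet hx)] with y hy
    simp [hy]

/-- Differentiation under the integral sign for a jointly `C¹` integrand. -/
lemma hasFDerivAt_intervalIntegral_of_contDiff {G : Type*} [NormedAddCommGroup G]
    [NormedSpace ℝ G] [ProperSpace G] {g : G × ℝ → ℝ} (hg : ContDiff ℝ 1 g) (a b : ℝ) (x : G) :
    HasFDerivAt (fun y => ∫ t in a..b, g (y, t))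
      (∫ t in a..b, (fderiv ℝ g (x, t)).comp (ContinuousLinearMap.inl ℝ G ℝ)) x := by
  have hcont : Continuous fun p : G × ℝ =>
      (fderiv ℝ g p).comp (ContinuousLinearMap.inl ℝ G ℝ) :=
    (hg.continuous_fderiv one_ne_zero).clm_comp continuous_const
  obtain ⟨M, hM⟩ := ((isCompact_closedBall x 1).prod
    (isCompact_uIcc (a := a) (b := b))).exists_bound_of_continuousOn hcont.continuousOn
  have hcg := hg.continuous
  refine intervalIntegral.hasFDerivAt_integral_of_dominated_of_fderiv_le
    (F := fun y t => g (y, t)) (s := Metric.closedBall x 1) (bound := fun _ => M)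
    (F' := fun y t => (fderiv ℝ g (y, t)).comp (ContinuousLinearMap.inl ℝ G ℝ))
    (Metric.closedBall_mem_nhds x one_pos) ?_ ?_ ?_ ?_ ?_ ?_
  · exact Eventually.of_forall fun y =>
      (hcg.comp (by fun_prop : Continuous fun t : ℝ => (y, t))).aestronglyMeasurable
  · exact (hcg.comp (by fun_prop : Continuous fun t : ℝ => (x, t))).intervalIntegrable a b
  · exact (hcont.comp (by fun_prop : Continuous fun t : ℝ => (x, t))).aestronglyMeasurable
  · exact Eventually.of_forall fun t ht y hy => hM (y, t) ⟨hy, Set.uIoc_subset_uIcc ht⟩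
  · exact intervalIntegrable_const
  · refine Eventually.of_forall fun t _ y _ => ?_
    have h1 := (hg.differentiable one_ne_zero (y, t)).hasFDerivAt
    exact h1.comp y (hasFDerivAt_prodMk_left y t)

lemma contDiff_intervalIntegral_of_contDiff {G : Type*} [NormedAddCommGroup G]
    [NormedSpace ℝ G] [ProperSpace G] {g : G × ℝ → ℝ} (hg : ContDiff ℝ 1 g) (a b : ℝ) :
    ContDiff ℝ 1 (fun y => ∫ t in a..b, g (y, t)) := by
  have hcont : Continuous fun p : G × ℝ =>
      (fderiv ℝ g p).comp (ContinuousLinearMap.inl ℝ G ℝ) :=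
    (hg.continuous_fderiv one_ne_zero).clm_comp continuous_const
  rw [contDiff_one_iff_fderiv]
  refine ⟨fun x => (hasFDerivAt_intervalIntegral_of_contDiff hg a b x).differentiableAt, ?_⟩
  simp_rw [funext fun x => (hasFDerivAt_intervalIntegral_of_contDiff hg a b x).fderiv]
  exact intervalIntegral.continuous_parametric_intervalIntegral_of_continuous'
    (f := fun y t => (fderiv ℝ g (y, t)).comp (ContinuousLinearMap.inl ℝ G ℝ)) hcont a b

lemma HasFDerivAt.hasDerivAt_mk_left {F : Type*} [NormedAddCommGroup F] [NormedSpace ℝ F]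
    {f : ℝ × ℝ → F} {f' : ℝ × ℝ →L[ℝ] F} {x : ℝ × ℝ} (hf : HasFDerivAt f f' x) :
    HasDerivAt (fun t => f (t, x.2)) (f' (1, 0)) x.1 :=
  HasFDerivAt.comp_hasDerivAt (f := fun t => (t, x.2)) x.1 hf
    ((hasDerivAt_id x.1).prodMk (hasDerivAt_const x.1 x.2))

lemma HasFDerivAt.hasDerivAt_mk_right {F : Type*} [NormedAddCommGroup F] [NormedSpace ℝ F]
    {f : ℝ × ℝ → F} {f' : ℝ × ℝ →L[ℝ] F} {x : ℝ × ℝ} (hf : HasFDerivAt f f' x) :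
    HasDerivAt (fun t => f (x.1, t)) (f' (0, 1)) x.2 :=
  HasFDerivAt.comp_hasDerivAt (f := fun t => (x.1, t)) x.2 hf
    ((hasDerivAt_const x.2 x.1).prodMk (hasDerivAt_id x.2))

/-- A vector potential whose curl is uniformly close to `1` on a square is, up to a gradient,
close to the constant-field potential centred at the middle of the square. -/
lemma exists_gauge {A : ℝ × ℝ → ℝ × ℝ} (hA : ContDiff ℝ 1 A) (c : ℝ × ℝ) (h δ : ℝ)
    (hδ : 0 ≤ δ)
    (hcurl : ∀ x ∈ Set.Icc (c.1 - h, c.2 - h) (c.1 + h, c.2 + h), |curlA A x - 1| ≤ δ) :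
    ∃ Φ : ℝ × ℝ → ℝ, ContDiff ℝ 1 Φ ∧
      ∀ x ∈ Set.Icc (c.1 - h, c.2 - h) (c.1 + h, c.2 + h),
        fderiv ℝ Φ x (1, 0) = (A x).1 - (A0 (x - c)).1 ∧
        |fderiv ℝ Φ x (0, 1) - ((A x).2 - (A0 (x - c)).2)| ≤ h * δ := by
  have h1 : ContDiff ℝ 1 fun y => (A y).1 := contDiff_fst.comp hA
  have h2 : ContDiff ℝ 1 fun y => (A y).2 := contDiff_snd.comp hA
  set φ : ℝ × ℝ → ℝ := fun x => ∫ s in (0 : ℝ)..1,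
    ((x.1 - c.1) * (A (c.1 + s * (x.1 - c.1), x.2)).1 +
      (x.2 - c.2) * (A (c.1, c.2 + s * (x.2 - c.2))).2) with hφdef
  have hφ : ContDiff ℝ 1 φ := by
    refine contDiff_intervalIntegral_of_contDiff (g := fun p : (ℝ × ℝ) × ℝ =>
      (p.1.1 - c.1) * (A (c.1 + p.2 * (p.1.1 - c.1), p.1.2)).1 +
      (p.1.2 - c.2) * (A (c.1, c.2 + p.2 * (p.1.2 - c.2))).2) ?_ 0 1
    refine ContDiff.add (ContDiff.mul (by fun_prop) ?_) (ContDiff.mul (by fun_prop) ?_)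
    · exact h1.comp (f := fun p : (ℝ × ℝ) × ℝ => (c.1 + p.2 * (p.1.1 - c.1), p.1.2))
        (by fun_prop)
    · exact h2.comp (f := fun p : (ℝ × ℝ) × ℝ => (c.1, c.2 + p.2 * (p.1.2 - c.2)))
        (by fun_prop)
  have hc1 : Continuous fun y => (A y).1 := h1.continuous
  have hc2 : Continuous fun y => (A y).2 := h2.continuous
  have hφeq : ∀ x, φ x = (∫ t in c.1..x.1, (A (t, x.2)).1) + ∫ t in c.2..x.2, (A (c.1, t)).2 := by
    intro x
    simp only [hφdef]
    rw [intervalIntegral.integral_add, intervalIntegral.integral_const_mul,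
      intervalIntegral.integral_const_mul]
    · have e1 := intervalIntegral.mul_integral_comp_add_mul (f := fun t => (A (t, x.2)).1)
        (a := 0) (b := 1) (x.1 - c.1) c.1
      have e2 := intervalIntegral.mul_integral_comp_add_mul (f := fun t => (A (c.1, t)).2)
        (a := 0) (b := 1) (x.2 - c.2) c.2
      simp only [mul_zero, add_zero, mul_one, add_sub_cancel] at e1 e2
      rw [← e1, ← e2]
      simp only [mul_comm _ (x.1 - c.1), mul_comm _ (x.2 - c.2)]
    · exact (continuous_const.mul (hc1.comp (by fun_prop :
        Continuous fun s : ℝ => (c.1 + s * (x.1 - c.1), x.2)))).intervalIntegrable _ _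
    · exact (continuous_const.mul (hc2.comp (by fun_prop :
        Continuous fun s : ℝ => (c.1, c.2 + s * (x.2 - c.2))))).intervalIntegrable _ _
  have hd1 : ∀ x, fderiv ℝ φ x (1, 0) = (A x).1 := by
    intro x
    have hl := (hφ.differentiable one_ne_zero x).hasFDerivAt.hasDerivAt_mk_left
    have hcx : Continuous fun t : ℝ => (A (t, x.2)).1 :=
      hc1.comp (by fun_prop : Continuous fun t : ℝ => (t, x.2))
    have hr : HasDerivAt (fun t => φ (t, x.2)) (A (x.1, x.2)).1 x.1 := by
      simp only [hφeq]
      exact (intervalIntegral.integral_hasDerivAt_right (hcx.intervalIntegrable _ _)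
        hcx.stronglyMeasurable.stronglyMeasurableAtFilter hcx.continuousAt).add_const _
    exact hl.unique hr
  have hcp1 : Continuous fun p => fderiv ℝ (fun y => (A y).1) p (0, 1) :=
    (h1.continuous_fderiv one_ne_zero).clm_apply continuous_const
  have hcp2 : Continuous fun p => fderiv ℝ (fun y => (A y).2) p (1, 0) :=
    (h2.continuous_fderiv one_ne_zero).clm_apply continuous_const
  have hd2 : ∀ x, fderiv ℝ φ x (0, 1) =
      (A x).2 - ∫ t in c.1..x.1, curlA A (t, x.2) := by
    intro x
    have hl := (hφ.differentiable one_ne_zero x).hasFDerivAt.hasDerivAt_mk_right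
    have hcx : Continuous fun t : ℝ => (A (c.1, t)).2 :=
      hc2.comp (by fun_prop : Continuous fun t : ℝ => (c.1, t))
    have hparam : HasDerivAt (fun r => ∫ t in c.1..x.1, (A (t, r)).1)
        (∫ t in c.1..x.1, fderiv ℝ (fun y => (A y).1) (t, x.2) (0, 1)) x.2 := by
      have hswap : ContDiff ℝ 1 fun p : ℝ × ℝ => (A (p.2, p.1)).1 :=
        h1.comp (f := fun p : ℝ × ℝ => (p.2, p.1)) (by fun_prop)
      have hF := (hasFDerivAt_intervalIntegral_of_contDiff hswap c.1 x.1 x.2).hasDerivAt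
      rw [ContinuousLinearMap.intervalIntegral_apply] at hF
      · refine hF.congr_deriv (intervalIntegral.integral_congr fun t _ => ?_)
        have e := ((h1.differentiable one_ne_zero (t, x.2)).hasFDerivAt).hasDerivAt_mk_right
        have e' := (hswap.differentiable one_ne_zero (x.2, t)).hasFDerivAt.hasDerivAt_mk_left
        simpa using e'.unique e
      · exact ((hswap.continuous_fderiv one_ne_zero).comp (by fun_prop :
          Continuous fun t : ℝ => (x.2, t))).clm_comp continuous_const |>.intervalIntegrable _ _
    have hr : HasDerivAt (fun t => φ (x.1, t))
        ((∫ t in c.1..x.1, fderiv ℝ (fun y => (A y).1) (t, x.2) (0, 1)) + (A (c.1, x.2)).2)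
        x.2 := by
      simp only [hφeq]
      exact hparam.add (intervalIntegral.integral_hasDerivAt_right (hcx.intervalIntegrable _ _)
        hcx.stronglyMeasurable.stronglyMeasurableAtFilter hcx.continuousAt)
    rw [hl.unique hr]
    have hft : ∫ t in c.1..x.1, fderiv ℝ (fun y => (A y).2) (t, x.2) (1, 0) =
        (A (x.1, x.2)).2 - (A (c.1, x.2)).2 :=
      intervalIntegral.integral_eq_sub_of_hasDerivAt (f := fun t => (A (t, x.2)).2)
        (f' := fun t => fderiv ℝ (fun y => (A y).2) (t, x.2) (1, 0))
        (fun t _ => (h2.differentiable one_ne_zero (t, x.2)).hasFDerivAt.hasDerivAt_mk_left)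
        ((hcp2.comp (by fun_prop : Continuous fun t : ℝ => (t, x.2))).intervalIntegrable _ _)
    simp only [curlA]
    rw [intervalIntegral.integral_sub, hft]
    · ring
    · exact (hcp2.comp (by fun_prop : Continuous fun t : ℝ => (t, x.2))).intervalIntegrable _ _
    · exact (hcp1.comp (by fun_prop : Continuous fun t : ℝ => (t, x.2))).intervalIntegrable _ _
  refine ⟨fun x => φ x + (x.1 - c.1) * (x.2 - c.2) / 2, hφ.add (by fun_prop), fun x hx => ?_⟩
  have hf1 : HasFDerivAt (fun p : ℝ × ℝ => p.1 - c.1) (ContinuousLinearMap.fst ℝ ℝ ℝ) x :=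
    hasFDerivAt_fst.sub_const _
  have hf2 : HasFDerivAt (fun p : ℝ × ℝ => p.2 - c.2) (ContinuousLinearMap.snd ℝ ℝ ℝ) x :=
    hasFDerivAt_snd.sub_const _
  have hΦ := (hφ.differentiable one_ne_zero x).hasFDerivAt.add ((hf1.mul hf2).mul_const (1 / 2))
  have hΦ' : fderiv ℝ (fun x => φ x + (x.1 - c.1) * (x.2 - c.2) / 2) x = _ :=
    (hΦ.congr_of_eventuallyEq (Eventually.of_forall fun y => by
      simp [div_eq_mul_inv])).fderiv
  rw [hΦ']
  constructor
  · simp [hd1, A0]; ring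
  · have hint : IntervalIntegrable (fun t => curlA A (t, x.2)) volume c.1 x.1 :=
      ((hcp2.comp (by fun_prop : Continuous fun t : ℝ => (t, x.2))).sub
        (hcp1.comp (by fun_prop : Continuous fun t : ℝ => (t, x.2)))).intervalIntegrable _ _
    have e : ∫ t in c.1..x.1, (curlA A (t, x.2) - 1) =
        (∫ t in c.1..x.1, curlA A (t, x.2)) - (x.1 - c.1) := by
      rw [intervalIntegral.integral_sub hint intervalIntegrable_const]
      simp
    have hx1 : |x.1 - c.1| ≤ h := abs_le.2 ⟨by linarith [hx.1.1], by linarith [hx.2.1]⟩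
    have hb : |∫ t in c.1..x.1, (curlA A (t, x.2) - 1)| ≤ δ * |x.1 - c.1| := by
      rw [← Real.norm_eq_abs]
      refine intervalIntegral.norm_integral_le_of_norm_le_const fun t ht => ?_
      have ht' := Set.uIoc_subset_uIcc ht
      have hh : 0 ≤ h := (abs_nonneg _).trans hx1
      have := Set.uIcc_subset_Icc (a₂ := c.1 - h) (b₂ := c.1 + h)
        ⟨by linarith, by linarith⟩ ⟨hx.1.1, hx.2.1⟩ ht'
      exact hcurl (t, x.2) ⟨⟨this.1, hx.1.2⟩, ⟨this.2, hx.2.2⟩⟩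
    rw [e] at hb
    have : (|(∫ t in c.1..x.1, curlA A (t, x.2)) - (x.1 - c.1)|) ≤ h * δ :=
      hb.trans (by rw [mul_comm]; gcongr)
    rw [abs_sub_comm] at this
    convert this using 2
    simp [hd2, A0]; ring

/-- The polynomial cutoff `(1 − (x₁−c₁)²/h²)(1 − (x₂−c₂)²/h²)`, which vanishes on the boundary of
the square of center `c` and half side-length `h`. -/
def squareCutoff (c : ℝ × ℝ) (h : ℝ) (x : ℝ × ℝ) : ℝ :=
  (1 - ((x.1 - c.1) / h) ^ 2) * (1 - ((x.2 - c.2) / h) ^ 2)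

lemma contDiff_squareCutoff {n : WithTop ℕ∞} (c : ℝ × ℝ) (h : ℝ) :
    ContDiff ℝ n (squareCutoff c h) := by
  unfold squareCutoff
  fun_prop

lemma sq_sub_div_le_one {a t h : ℝ} (h0 : 0 < h) (h1 : a - h ≤ t) (h2 : t ≤ a + h) :
    ((t - a) / h) ^ 2 ≤ 1 := by
  rw [sq_le_one_iff_abs_le_one, abs_div, abs_of_pos h0, div_le_one h0, abs_le]
  constructor <;> linarith

lemma squareCutoff_mem_Icc {c x : ℝ × ℝ} {h : ℝ} (h0 : 0 < h)
    (hx : x ∈ Set.Icc (c.1 - h, c.2 - h) (c.1 + h, c.2 + h)) :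
    squareCutoff c h x ∈ Set.Icc (0 : ℝ) 1 := by
  have h1 := sq_sub_div_le_one h0 hx.1.1 hx.2.1
  have h2 := sq_sub_div_le_one h0 hx.1.2 hx.2.2
  have h1' := sq_nonneg ((x.1 - c.1) / h)
  have h2' := sq_nonneg ((x.2 - c.2) / h)
  exact ⟨mul_nonneg (by linarith) (by linarith),
    mul_le_one₀ (by linarith) (by linarith) (by linarith)⟩

lemma squareCutoff_ge {c x : ℝ × ℝ} {h : ℝ} (h0 : 0 < h) (hx : x ∈ openSquare c (h / 2)) :
    9 / 16 ≤ squareCutoff c h x := by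
  have key : ∀ a t : ℝ, t ∈ Set.Ioo (a - h / 2) (a + h / 2) → 3 / 4 ≤ 1 - ((t - a) / h) ^ 2 := by
    intro a t ht
    have h1 := sq_sub_div_le_one (half_pos h0) ht.1.le ht.2.le
    have : ((t - a) / (h / 2)) ^ 2 = 4 * ((t - a) / h) ^ 2 := by field_simp; ring
    linarith
  have k1 := key _ _ hx.1
  have k2 := key _ _ hx.2
  calc (9 / 16 : ℝ) = 3 / 4 * (3 / 4) := by norm_num
    _ ≤ _ := mul_le_mul k1 k2 (by norm_num) (by linarith)

lemma squareCutoff_eq_zero {c x : ℝ × ℝ} {h : ℝ} (h0 : 0 < h)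
    (hx : |x.1 - c.1| = h ∨ |x.2 - c.2| = h) : squareCutoff c h x = 0 := by
  have key : ∀ s : ℝ, |s| = h → 1 - (s / h) ^ 2 = 0 := by
    intro s hs
    rw [div_pow, ← sq_abs s, hs, div_self (by positivity), sub_self]
  rcases hx with hx | hx <;> simp [squareCutoff, key _ hx]

lemma fderiv_squareCutoff_sq_le {c x : ℝ × ℝ} {h : ℝ} (h0 : 0 < h)
    (hx : x ∈ Set.Icc (c.1 - h, c.2 - h) (c.1 + h, c.2 + h)) :
    fderiv ℝ (squareCutoff c h) x (1, 0) ^ 2 + fderiv ℝ (squareCutoff c h) x (0, 1) ^ 2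
      ≤ 8 / h ^ 2 := by
  have hd := ((contDiff_squareCutoff (n := 1) c h).differentiable one_ne_zero x).hasFDerivAt
  have hp : ∀ a t : ℝ, HasDerivAt (fun s : ℝ => 1 - ((s - a) / h) ^ 2)
      (-(2 * ((t - a) / h) * (1 / h))) t := by
    intro a t
    have := ((((hasDerivAt_id t).sub_const a).div_const h).pow 2).const_sub 1
    exact this.congr_deriv (by simp)
  have e1 := hd.hasDerivAt_mk_left.unique ((hp c.1 x.1).mul_const (1 - ((x.2 - c.2) / h) ^ 2))
  have e2 := hd.hasDerivAt_mk_right.unique ((hp c.2 x.2).const_mul (1 - ((x.1 - c.1) / h) ^ 2))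
  rw [e1, e2]
  have h1 := sq_sub_div_le_one h0 hx.1.1 hx.2.1
  have h2 := sq_sub_div_le_one h0 hx.1.2 hx.2.2
  set p := (x.1 - c.1) / h
  set q := (x.2 - c.2) / h
  have h1' := sq_nonneg p
  have h2' := sq_nonneg q
  have b1 : p ^ 2 * (1 - q ^ 2) ^ 2 ≤ 1 :=
    mul_le_one₀ h1 (sq_nonneg _) (pow_le_one₀ (by linarith) (by linarith))
  have b2 : q ^ 2 * (1 - p ^ 2) ^ 2 ≤ 1 :=
    mul_le_one₀ h2 (sq_nonneg _) (pow_le_one₀ (by linarith) (by linarith))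
  calc _ = (p ^ 2 * (1 - q ^ 2) ^ 2 + q ^ 2 * (1 - p ^ 2) ^ 2) * (4 / h ^ 2) := by ring
    _ ≤ 2 * (4 / h ^ 2) := by gcongr; linarith
    _ = 8 / h ^ 2 := by ring

/-- The flux `χ² Re(ψ̄ ∂_e ψ)`. -/
def cutoffFlux (χ : ℝ × ℝ → ℝ) (ψ : ℝ × ℝ → ℂ) (e x : ℝ × ℝ) : ℝ :=
  χ x ^ 2 * ((ψ x).re * (fderiv ℝ ψ x e).re + (ψ x).im * (fderiv ℝ ψ x e).im)

lemma contDiff_cutoffFlux {χ : ℝ × ℝ → ℝ} {ψ : ℝ × ℝ → ℂ} (hχ : ContDiff ℝ 1 χ)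
    (hψ : ContDiff ℝ 2 ψ) (e : ℝ × ℝ) : ContDiff ℝ 1 (cutoffFlux χ ψ e) := by
  have h1 : ContDiff ℝ 1 ψ := hψ.of_le one_le_two
  have hP : ContDiff ℝ 1 fun x => fderiv ℝ ψ x e :=
    (hψ.fderiv_right (m := 1) (by norm_num)).clm_apply contDiff_const
  refine (hχ.pow 2).mul (ContDiff.add (ContDiff.mul ?_ ?_) (ContDiff.mul ?_ ?_))
  · exact Complex.reCLM.contDiff.comp h1
  · exact Complex.reCLM.contDiff.comp hP
  · exact Complex.imCLM.contDiff.comp h1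
  · exact Complex.imCLM.contDiff.comp hP

lemma fderiv_cutoffFlux {χ : ℝ × ℝ → ℝ} {ψ : ℝ × ℝ → ℂ} (hχ : ContDiff ℝ 1 χ)
    (hψ : ContDiff ℝ 2 ψ) (e x : ℝ × ℝ) :
    fderiv ℝ (cutoffFlux χ ψ e) x e =
      2 * χ x * fderiv ℝ χ x e *
        ((ψ x).re * (fderiv ℝ ψ x e).re + (ψ x).im * (fderiv ℝ ψ x e).im) +
      χ x ^ 2 * ((fderiv ℝ ψ x e).re ^ 2 + (fderiv ℝ ψ x e).im ^ 2 +
        (ψ x).re * (fderiv ℝ (fun y => fderiv ℝ ψ y e) x e).re +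
        (ψ x).im * (fderiv ℝ (fun y => fderiv ℝ ψ y e) x e).im) := by
  have hP : ContDiff ℝ 1 fun x => fderiv ℝ ψ x e :=
    (hψ.fderiv_right (m := 1) (by norm_num)).clm_apply contDiff_const
  have d1 := (hψ.differentiable two_ne_zero x).hasFDerivAt
  have d2 := (hP.differentiable one_ne_zero x).hasFDerivAt
  have dχ := (hχ.differentiable one_ne_zero x).hasFDerivAt
  have r1 := Complex.reCLM.hasFDerivAt.comp x d1
  have i1 := Complex.imCLM.hasFDerivAt.comp x d1
  have r2 := Complex.reCLM.hasFDerivAt.comp x d2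
  have i2 := Complex.imCLM.hasFDerivAt.comp x d2
  have H := (dχ.pow 2).mul ((r1.mul r2).add (i1.mul i2))
  have H' : fderiv ℝ (cutoffFlux χ ψ e) x = _ := H.fderiv
  rw [H']
  simp
  ring

/-- A `C¹` field with vanishing normal component on the boundary of a square has divergence of
mean zero. -/
lemma integral_divergence_eq_zero {f g : ℝ × ℝ → ℝ} (hf : ContDiff ℝ 1 f) (hg : ContDiff ℝ 1 g)
    (c : ℝ × ℝ) {h : ℝ} (h0 : 0 < h) (hf0 : ∀ x : ℝ × ℝ, |x.1 - c.1| = h → f x = 0)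
    (hg0 : ∀ x : ℝ × ℝ, |x.2 - c.2| = h → g x = 0) :
    ∫ x in Set.Icc (c.1 - h, c.2 - h) (c.1 + h, c.2 + h),
      (fderiv ℝ f x (1, 0) + fderiv ℝ g x (0, 1)) = 0 := by
  have hcont : Continuous fun x => fderiv ℝ f x (1, 0) + fderiv ℝ g x (0, 1) :=
    ((hf.continuous_fderiv one_ne_zero).clm_apply continuous_const).add
      ((hg.continuous_fderiv one_ne_zero).clm_apply continuous_const)
  rw [integral_divergence_prod_Icc_of_hasFDerivAt_of_le f g (fderiv ℝ f) (fderiv ℝ g)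
    (c.1 - h, c.2 - h) (c.1 + h, c.2 + h) ⟨by simp; linarith, by simp; linarith⟩
    hf.continuous.continuousOn hg.continuous.continuousOn
    (fun x _ => (hf.differentiable one_ne_zero x).hasFDerivAt)
    (fun x _ => (hg.differentiable one_ne_zero x).hasFDerivAt)
    (hcont.continuousOn.integrableOn_compact isCompact_Icc)]
  have f1 : ∀ y, f (c.1 + h, y) = 0 := fun y => hf0 _ (by simp [abs_of_pos h0])
  have f2 : ∀ y, f (c.1 - h, y) = 0 := fun y => hf0 _ (by simp [abs_of_pos h0])
  have g1 : ∀ y, g (y, c.2 + h) = 0 := fun y => hg0 _ (by simp [abs_of_pos h0])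
  have g2 : ∀ y, g (y, c.2 - h) = 0 := fun y => hg0 _ (by simp [abs_of_pos h0])
  simp [f1, f2, g1, g2]

/-- The localized energy density of a solution is, up to a divergence, of zeroth order. -/
lemma magGradSqA_cutoff_mul_eq {κ H : ℝ} {A : ℝ × ℝ → ℝ × ℝ} {ψ : ℝ × ℝ → ℂ} {χ : ℝ × ℝ → ℝ}
    (hχ : ContDiff ℝ 1 χ) (hψ : ContDiff ℝ 2 ψ) {x : ℝ × ℝ}
    (hGL : -magLapA (κ * H) A ψ x = ((κ ^ 2 * (1 - ‖ψ x‖ ^ 2) : ℝ) : ℂ) * ψ x) :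
    magGradSqA (κ * H) A (fun y => (χ y : ℂ) * ψ y) x =
      fderiv ℝ (cutoffFlux χ ψ (1, 0)) x (1, 0) + fderiv ℝ (cutoffFlux χ ψ (0, 1)) x (0, 1) +
      κ ^ 2 * χ x ^ 2 * (‖ψ x‖ ^ 2 - ‖ψ x‖ ^ 4) +
      (fderiv ℝ χ x (1, 0) ^ 2 + fderiv ℝ χ x (0, 1) ^ 2) * ‖ψ x‖ ^ 2 := by
  have dψ := (hψ.differentiable two_ne_zero x).hasFDerivAt
  have dχ := Complex.ofRealCLM.hasFDerivAt.comp x (hχ.differentiable one_ne_zero x).hasFDerivAt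
  have hu : ∀ e, fderiv ℝ (fun y => (χ y : ℂ) * ψ y) x e =
      (χ x : ℂ) * fderiv ℝ ψ x e + (fderiv ℝ χ x e : ℂ) * ψ x := by
    intro e
    have H' : fderiv ℝ (fun y => (χ y : ℂ) * ψ y) x = _ := (dχ.mul dψ).fderiv
    rw [H']
    simp [mul_comm]
  rw [fderiv_cutoffFlux hχ hψ, fderiv_cutoffFlux hχ hψ]
  unfold magGradSqA
  rw [hu, hu]
  beta_reduce
  unfold magLapA lap at hGL
  have h4 : ‖ψ x‖ ^ 4 = (‖ψ x‖ ^ 2) ^ 2 := by ring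
  rw [h4]
  generalize fderiv ℝ ψ x (1, 0) = P₁ at *
  generalize fderiv ℝ ψ x (0, 1) = P₂ at *
  generalize fderiv ℝ (fun y => fderiv ℝ ψ y (1, 0)) x (1, 0) = S₁ at *
  generalize fderiv ℝ (fun y => fderiv ℝ ψ y (0, 1)) x (0, 1) = S₂ at *
  generalize fderiv ℝ χ x (1, 0) = d₁ at *
  generalize fderiv ℝ χ x (0, 1) = d₂ at *
  generalize ψ x = z at *
  generalize χ x = t at *
  generalize divA A x = D at *
  simp only [Complex.sq_norm, Complex.normSq_apply] at hGL ⊢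
  have hre := congrArg Complex.re hGL
  have him := congrArg Complex.im hGL
  simp only [Complex.neg_re, Complex.neg_im, Complex.sub_re, Complex.sub_im, Complex.add_re,
    Complex.add_im, Complex.mul_re, Complex.mul_im, Complex.ofReal_re, Complex.ofReal_im,
    Complex.I_re, Complex.I_im, Complex.re_ofNat, Complex.im_ofNat] at hre him ⊢
  linear_combination t ^ 2 * z.re * hre + t ^ 2 * z.im * him

lemma norm_sub_sq_le_weighted (α β : ℂ) {ε : ℝ} (hε : 0 < ε) :
    ‖α - β‖ ^ 2 ≤ (1 + ε) * ‖α‖ ^ 2 + (1 + ε⁻¹) * ‖β‖ ^ 2 := by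
  have h1 : ‖α - β‖ ^ 2 ≤ (‖α‖ + ‖β‖) ^ 2 := by
    gcongr
    exact norm_sub_le α β
  have h2 : (1 + ε) * ‖α‖ ^ 2 + (1 + ε⁻¹) * ‖β‖ ^ 2 - (‖α‖ + ‖β‖) ^ 2 =
      ε⁻¹ * (ε * ‖α‖ - ‖β‖) ^ 2 := by
    field_simp
    ring
  have h3 : 0 ≤ ε⁻¹ * (ε * ‖α‖ - ‖β‖) ^ 2 := by positivity
  linarith

/-- Change of gauge and of vector potential in the magnetic gradient. -/
lemma magGradSqA_gauge_le {Φ : ℝ × ℝ → ℝ} {u : ℝ × ℝ → ℂ} (hΦ : ContDiff ℝ 1 Φ)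
    (hu : ContDiff ℝ 1 u) (A B : ℝ × ℝ → ℝ × ℝ) (c : ℝ) {ε : ℝ} (hε : 0 < ε) (x : ℝ × ℝ) :
    magGradSqA c B (fun y => Complex.exp (-(Complex.I * c * Φ y)) * u y) x ≤
      (1 + ε) * magGradSqA c A u x + (1 + ε⁻¹) * (c ^ 2 *
        ((fderiv ℝ Φ x (1, 0) - ((A x).1 - (B x).1)) ^ 2 +
          (fderiv ℝ Φ x (0, 1) - ((A x).2 - (B x).2)) ^ 2) * ‖u x‖ ^ 2) := by
  have du := (hu.differentiable one_ne_zero x).hasFDerivAt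
  have dΦ := Complex.ofRealCLM.hasFDerivAt.comp x (hΦ.differentiable one_ne_zero x).hasFDerivAt
  have hw : ∀ e, fderiv ℝ (fun y => Complex.exp (-(Complex.I * c * Φ y)) * u y) x e =
      Complex.exp (-(Complex.I * c * Φ x)) *
        (fderiv ℝ u x e - Complex.I * c * (fderiv ℝ Φ x e : ℂ) * u x) := by
    intro e
    have H' : fderiv ℝ (fun y => Complex.exp (-(Complex.I * c * Φ y)) * u y) x = _ :=
      (((dΦ.const_mul (Complex.I * c)).neg.cexp).mul du).fderiv
    rw [H']
    simp
    ring
  have hnorm : ‖Complex.exp (-(Complex.I * c * Φ x))‖ = 1 := by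
    rw [Complex.norm_exp]
    simp
  have key : ∀ (P : ℂ) (p a b : ℝ),
      ‖Complex.exp (-(Complex.I * c * Φ x)) * (P - Complex.I * c * (p : ℂ) * u x) -
        Complex.I * c * (b : ℂ) * (Complex.exp (-(Complex.I * c * Φ x)) * u x)‖ ^ 2 ≤
      (1 + ε) * ‖P - Complex.I * c * (a : ℂ) * u x‖ ^ 2 +
        (1 + ε⁻¹) * (c ^ 2 * (p - (a - b)) ^ 2 * ‖u x‖ ^ 2) := by
    intro P p a b
    have e1 : Complex.exp (-(Complex.I * c * Φ x)) * (P - Complex.I * c * (p : ℂ) * u x) -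
        Complex.I * c * (b : ℂ) * (Complex.exp (-(Complex.I * c * Φ x)) * u x) =
        Complex.exp (-(Complex.I * c * Φ x)) * ((P - Complex.I * c * (a : ℂ) * u x) -
          Complex.I * ((c * (p - (a - b)) : ℝ) : ℂ) * u x) := by
      push_cast
      ring
    rw [e1, norm_mul, hnorm, one_mul]
    refine (norm_sub_sq_le_weighted _ _ hε).trans_eq ?_
    rw [norm_mul, norm_mul, Complex.norm_I, Complex.norm_real, one_mul, mul_pow,
      Real.norm_eq_abs, sq_abs, mul_pow]
  unfold magGradSqA
  rw [hw, hw]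
  have k1 := key (fderiv ℝ u x (1, 0)) (fderiv ℝ Φ x (1, 0)) (A x).1 (B x).1
  have k2 := key (fderiv ℝ u x (0, 1)) (fderiv ℝ Φ x (0, 1)) (A x).2 (B x).2
  linarith

/-- Rescaling of the bulk energy from `Q_{2sh}` to the square of half side-length `h`. -/
lemma Eblk_comp_scaling {w : ℝ × ℝ → ℂ} (hw : ContDiff ℝ 1 w) (c : ℝ × ℝ) (b h : ℝ) {s : ℝ}
    (hs : 0 < s) :
    Eblk (fun y => w (c + s⁻¹ • y)) b (2 * s * h) =
      ∫ x in openSquare c h, (b * magGradSqA (s ^ 2) (fun x => A0 (x - c)) w x +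
        s ^ 2 * (-‖w x‖ ^ 2 + (1 / 2) * ‖w x‖ ^ 4)) := by
  have hgrad : ∀ y, magGradSq (fun y => w (c + s⁻¹ • y)) y =
      (s ^ 2)⁻¹ * magGradSqA (s ^ 2) (fun x => A0 (x - c)) w (c + s⁻¹ • y) := by
    intro y
    have hd : ∀ e, fderiv ℝ (fun y => w (c + s⁻¹ • y)) y e =
        (s⁻¹ : ℂ) * fderiv ℝ w (c + s⁻¹ • y) e := by
      intro e
      have h1 : HasFDerivAt (fun y : ℝ × ℝ => c + s⁻¹ • y)
          (s⁻¹ • ContinuousLinearMap.id ℝ (ℝ × ℝ)) y :=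
        ((hasFDerivAt_id y).const_smul s⁻¹).const_add c
      have h2 := (hw.differentiable one_ne_zero (c + s⁻¹ • y)).hasFDerivAt.comp y h1
      have h3 : fderiv ℝ (fun y => w (c + s⁻¹ • y)) y = _ := h2.fderiv
      rw [h3]
      simp
    have key : ∀ (P : ℂ) (a : ℝ), ‖(s⁻¹ : ℂ) * P - Complex.I * (a : ℂ) * w (c + s⁻¹ • y)‖ ^ 2 =
        (s ^ 2)⁻¹ * ‖P - Complex.I * ((s ^ 2 : ℝ) : ℂ) * ((s⁻¹ * a : ℝ) : ℂ) *
          w (c + s⁻¹ • y)‖ ^ 2 := by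
      intro P a
      have hs' : (s : ℂ) ≠ 0 := by exact_mod_cast hs.ne'
      have e1 : (s⁻¹ : ℂ) * P - Complex.I * (a : ℂ) * w (c + s⁻¹ • y) =
          ((s⁻¹ : ℝ) : ℂ) * (P - Complex.I * ((s ^ 2 : ℝ) : ℂ) * ((s⁻¹ * a : ℝ) : ℂ) *
          w (c + s⁻¹ • y)) := by
        push_cast
        field_simp
      rw [e1, norm_mul, Complex.norm_real, mul_pow, Real.norm_eq_abs, sq_abs, inv_pow]
    unfold magGradSq magGradSqA
    rw [hd, hd, key, key]
    simp only [A0, add_sub_cancel_left, Prod.smul_fst, Prod.smul_snd, smul_eq_mul]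
    rw [← mul_add]
    congr 6 <;> (push_cast; ring)
  set G : ℝ × ℝ → ℝ := fun x => b * magGradSqA (s ^ 2) (fun x => A0 (x - c)) w x +
        s ^ 2 * (-‖w x‖ ^ 2 + (1 / 2) * ‖w x‖ ^ 4) with hG
  have hset : s⁻¹ • QR (2 * s * h) = (fun z => c + z) ⁻¹' openSquare c h := by
    ext z
    rw [Set.mem_smul_set_iff_inv_smul_mem₀ (inv_ne_zero hs.ne'), inv_inv]
    have e : ∀ t : ℝ, s * t ∈ Set.Ioo (-(2 * s * h) / 2) (2 * s * h / 2) ↔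
        t ∈ Set.Ioo (-h) h := by
      intro t
      have e1 : -(2 * s * h) / 2 = s * -h := by ring
      have e2 : 2 * s * h / 2 = s * h := by ring
      rw [e1, e2, Set.mem_Ioo, Set.mem_Ioo, mul_lt_mul_iff_right₀ hs, mul_lt_mul_iff_right₀ hs]
    have e' : ∀ a t : ℝ, a + t ∈ Set.Ioo (a - h) (a + h) ↔ t ∈ Set.Ioo (-h) h := by
      intro a t
      rw [Set.mem_Ioo, Set.mem_Ioo]
      constructor <;> rintro ⟨_, _⟩ <;> constructor <;> linarith
    simp only [QR, openSquare, Set.mem_preimage, Set.mem_prod, Prod.smul_fst, Prod.smul_snd,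
      smul_eq_mul, Prod.fst_add, Prod.snd_add, e, e']
  calc Eblk (fun y => w (c + s⁻¹ • y)) b (2 * s * h)
      = ∫ y in QR (2 * s * h), (s ^ 2)⁻¹ * G (c + s⁻¹ • y) := by
        unfold Eblk
        congr 1
        ext y
        rw [hgrad, hG]
        field_simp
        ring
    _ = (s ^ 2)⁻¹ * ∫ y in QR (2 * s * h), G (c + s⁻¹ • y) := integral_const_mul _ _
    _ = (s ^ 2)⁻¹ * (s ^ 2 * ∫ z in s⁻¹ • QR (2 * s * h), G (c + z)) := by
        rw [Measure.setIntegral_comp_smul_of_pos volume (fun z => G (c + z)) _ (inv_pos.2 hs)]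
        simp
    _ = ∫ z in s⁻¹ • QR (2 * s * h), G (c + z) := by
        field_simp
    _ = ∫ x in openSquare c h, G x := by
        rw [hset]
        exact (measurePreserving_add_left volume c).setIntegral_preimage_emb
          (measurableEmbedding_addLeft c) G _

lemma dirichletClass_comp_scaling {w : ℝ × ℝ → ℂ} (hw : ContDiff ℝ 1 w) {c : ℝ × ℝ} {h s : ℝ}
    (hs : 0 < s) (h0 : 0 < h)
    (hw0 : ∀ x : ℝ × ℝ, |x.1 - c.1| = h ∨ |x.2 - c.2| = h → w x = 0) :
    DirichletClass (fun y => w (c + s⁻¹ • y)) (2 * s * h) := by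
  have hR : 0 < 2 * s * h := by positivity
  refine ⟨(hw.comp (by fun_prop)).contDiffOn, fun x hx => hw0 _ ?_⟩
  have hopen : IsOpen (QR (2 * s * h)) := isOpen_Ioo.prod isOpen_Ioo
  rw [hopen.frontier_eq, QR, closure_prod_eq, closure_Ioo (by linarith)] at hx
  obtain ⟨⟨⟨a1, a2⟩, ⟨a3, a4⟩⟩, hx'⟩ := hx
  have key : ∀ t : ℝ, |t| = s * h → |s⁻¹ * t| = h := by
    intro t ht
    rw [abs_mul, ht, abs_of_pos (inv_pos.2 hs), inv_mul_cancel_left₀ hs.ne']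
  by_contra hne
  push Not at hne
  simp only [Prod.fst_add, Prod.snd_add, Prod.smul_fst, Prod.smul_snd, smul_eq_mul,
    add_sub_cancel_left] at hne
  have n1 : |x.1| ≠ s * h := fun H => hne.1 (key _ H)
  have n2 : |x.2| ≠ s * h := fun H => hne.2 (key _ H)
  have l1 := abs_lt.1 (lt_of_le_of_ne (abs_le.2 ⟨by linarith, by linarith⟩) n1)
  have l2 := abs_lt.1 (lt_of_le_of_ne (abs_le.2 ⟨by linarith, by linarith⟩) n2)
  exact hx' ⟨⟨by linarith [l1.1], by linarith [l1.2]⟩, ⟨by linarith [l2.1], by linarith [l2.2]⟩⟩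

lemma openSquare_ae_eq_Icc (c : ℝ × ℝ) (h : ℝ) :
    openSquare c h =ᵐ[volume] Set.Icc (c.1 - h, c.2 - h) (c.1 + h, c.2 + h) := by
  rw [openSquare, Set.Icc_prod_eq]
  exact Measure.set_prod_ae_eq Ioo_ae_eq_Icc Ioo_ae_eq_Icc

lemma continuous_magGradSqA {A : ℝ × ℝ → ℝ × ℝ} {u : ℝ × ℝ → ℂ} (hA : Continuous A)
    (hu : ContDiff ℝ 1 u) (c : ℝ) : Continuous (magGradSqA c A u) := by
  have hf : ∀ e, Continuous fun x => fderiv ℝ u x e := fun e =>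
    (hu.continuous_fderiv one_ne_zero).clm_apply continuous_const
  have h1 := hf (1, 0)
  have h2 := hf (0, 1)
  have hu' := hu.continuous
  unfold magGradSqA
  fun_prop

/-- The scalar inequality behind the pointwise energy comparison: `q = √κ`, `t` is the cutoff,
`T = |ψ|²`, `M` and `N` are magnetic energy densities before and after the change of gauge,
`r` is the squared error on the potential and `D` is a divergence. -/
lemma energy_density_algebra {q H C₁ M N D t T r g : ℝ} (hq : 1 ≤ q) (hH : 0 < H)
    (hHκ : H ≤ q ^ 2) (ht0 : 0 ≤ t) (ht1 : t ≤ 1) (hT0 : 0 ≤ T) (hT1 : T ≤ 1) (hr0 : 0 ≤ r)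
    (hr : r ≤ 4 * C₁ ^ 2 / q ^ 6) (hg : g ≤ 2 * q ^ 2) (hM0 : 0 ≤ M)
    (hM : M = D + (q ^ 2) ^ 2 * t ^ 2 * (T - T ^ 2) + g * T)
    (hN : N ≤ (1 + q⁻¹) * M + (1 + q⁻¹⁻¹) * ((q ^ 2 * H) ^ 2 * r * (t ^ 2 * T))) :
    (1 - q⁻¹) * H / q ^ 2 * N + q ^ 2 * H * (-(t ^ 2 * T) + 1 / 2 * (t ^ 2 * T) ^ 2) ≤
      H / q ^ 2 * (D - (q ^ 2) ^ 2 / 4 * (t ^ 2 * T ^ 2) + (2 + 16 * C₁ ^ 4) * q ^ 2) := by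
  have hq0 : 0 < q := by linarith
  have hqi : q⁻¹ ≤ 1 := inv_le_one_of_one_le₀ hq
  have hqi0 : 0 < q⁻¹ := inv_pos.2 hq0
  have ht2 : t ^ 2 ≤ 1 := pow_le_one₀ ht0 ht1
  have hc : (q ^ 2 * H) ^ 2 * r ≤ 4 * C₁ ^ 2 * q ^ 2 := by
    calc (q ^ 2 * H) ^ 2 * r ≤ (q ^ 2 * q ^ 2) ^ 2 * (4 * C₁ ^ 2 / q ^ 6) := by gcongr
      _ = 4 * C₁ ^ 2 * q ^ 2 := by field_simp
  have hN' : (1 - q⁻¹) * N ≤ M + 4 * C₁ ^ 2 * q ^ 3 * (t ^ 2 * T) := by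
    have s1 : (1 - q⁻¹) * N ≤ (1 - q⁻¹) * ((1 + q⁻¹) * M +
        (1 + q⁻¹⁻¹) * ((q ^ 2 * H) ^ 2 * r * (t ^ 2 * T))) :=
      mul_le_mul_of_nonneg_left hN (by linarith)
    have s2 : (1 - q⁻¹) * ((1 + q⁻¹) * M +
        (1 + q⁻¹⁻¹) * ((q ^ 2 * H) ^ 2 * r * (t ^ 2 * T))) =
        (1 - q⁻¹ ^ 2) * M + (q - q⁻¹) * ((q ^ 2 * H) ^ 2 * r * (t ^ 2 * T)) := by
      field_simp
      ring
    have s3 : (1 - q⁻¹ ^ 2) * M ≤ M :=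
      mul_le_of_le_one_left hM0 (by linarith [sq_nonneg q⁻¹])
    have s4 : (q - q⁻¹) * ((q ^ 2 * H) ^ 2 * r * (t ^ 2 * T)) ≤
        q * (4 * C₁ ^ 2 * q ^ 2 * (t ^ 2 * T)) := by
      gcongr
      linarith
    calc _ ≤ _ := s1.trans_eq s2
      _ ≤ M + q * (4 * C₁ ^ 2 * q ^ 2 * (t ^ 2 * T)) := add_le_add s3 s4
      _ = _ := by ring
  have hgT : g * T ≤ 2 * q ^ 2 := by
    calc g * T ≤ 2 * q ^ 2 * T := by gcongr
      _ ≤ 2 * q ^ 2 * 1 := by gcongr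
      _ = _ := mul_one _
  have ht4 : (t ^ 2 * T) ^ 2 ≤ t ^ 2 * T ^ 2 := by
    calc (t ^ 2 * T) ^ 2 = t ^ 2 * (t ^ 2 * T ^ 2) := by ring
      _ ≤ t ^ 2 * T ^ 2 := mul_le_of_le_one_left (by positivity) ht2
  have hyoung : 4 * C₁ ^ 2 * q ^ 3 * (t ^ 2 * T) ≤
      (q ^ 2) ^ 2 / 4 * (t ^ 2 * T ^ 2) + 16 * C₁ ^ 4 * q ^ 2 := by
    have h1 := sq_nonneg (q ^ 2 * t * T / 2 - 4 * C₁ ^ 2 * q * t)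
    have h2 : 16 * C₁ ^ 4 * q ^ 2 * t ^ 2 ≤ 16 * C₁ ^ 4 * q ^ 2 :=
      mul_le_of_le_one_right (by positivity) ht2
    linarith
  have h5 : (q ^ 2) ^ 2 / 2 * (t ^ 2 * T) ^ 2 ≤ (q ^ 2) ^ 2 / 2 * (t ^ 2 * T ^ 2) := by gcongr
  have e : (1 - q⁻¹) * H / q ^ 2 * N + q ^ 2 * H * (-(t ^ 2 * T) + 1 / 2 * (t ^ 2 * T) ^ 2) =
      H / q ^ 2 * ((1 - q⁻¹) * N - (q ^ 2) ^ 2 * (t ^ 2 * T) +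
        (q ^ 2) ^ 2 / 2 * (t ^ 2 * T) ^ 2) := by
    field_simp
    ring
  rw [e]
  refine mul_le_mul_of_nonneg_left ?_ (by positivity)
  linarith

/-- The `L⁴` estimate for globally smooth data satisfying the equation on a closed square. -/
lemma integral_norm_pow_four_le {κ H C₁ E : ℝ} {A : ℝ × ℝ → ℝ × ℝ} {ψ : ℝ × ℝ → ℂ} {c : ℝ × ℝ}
    (hκ : 1 ≤ κ) (hH : 0 < H) (hHκ : H ≤ κ) (hC₁ : 0 < C₁) (hA : ContDiff ℝ 2 A)
    (hψ : ContDiff ℝ 2 ψ) {h : ℝ} (hh : h = 2 * (Real.sqrt κ)⁻¹)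
    (hcurl : ∀ x ∈ Set.Icc (c.1 - h, c.2 - h) (c.1 + h, c.2 + h), |curlA A x - 1| ≤ C₁ / κ)
    (hGL : GLequation κ H A ψ (Set.Icc (c.1 - h, c.2 - h) (c.1 + h, c.2 + h)))
    (hψ1 : ∀ x ∈ Set.Icc (c.1 - h, c.2 - h) (c.1 + h, c.2 + h), ‖ψ x‖ ≤ 1)
    (hE : ∀ v : ℝ × ℝ → ℂ, DirichletClass v (4 * Real.sqrt H) →
        Eblk v ((1 - (Real.sqrt κ)⁻¹) * H / κ) (4 * Real.sqrt H)
          ≥ (4 * Real.sqrt H) ^ 2 * E) :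
    κ ^ 2 / 4 * ((9 / 16) ^ 2 * ∫ x in openSquare c (Real.sqrt κ)⁻¹, ‖ψ x‖ ^ 4) ≤
      16 * (2 + 16 * C₁ ^ 4) - 16 * κ * E := by
  have hκ0 : 0 < κ := by linarith
  obtain ⟨q, hq⟩ : ∃ q, q = Real.sqrt κ := ⟨_, rfl⟩
  have hq1 : 1 ≤ q := by rw [hq]; exact Real.one_le_sqrt.2 hκ
  have hq0 : 0 < q := by linarith
  have hqκ : κ = q ^ 2 := by rw [hq, Real.sq_sqrt hκ0.le]
  have h0 : 0 < h := by rw [hh, ← hq]; positivity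
  set K := Set.Icc (c.1 - h, c.2 - h) (c.1 + h, c.2 + h) with hK
  have hKc : IsCompact K := isCompact_Icc
  obtain ⟨Φ, hΦ, hΦK⟩ := exists_gauge (hA.of_le one_le_two) c h (C₁ / κ) (by positivity) hcurl
  set χ := squareCutoff c h with hχdef
  have hχ : ContDiff ℝ 1 χ := contDiff_squareCutoff c h
  have hψ' : ContDiff ℝ 1 ψ := hψ.of_le one_le_two
  set u : ℝ × ℝ → ℂ := fun y => (χ y : ℂ) * ψ y with hu
  have huC : ContDiff ℝ 1 u := (Complex.ofRealCLM.contDiff.comp hχ).mul hψ'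
  set w : ℝ × ℝ → ℂ := fun y =>
    Complex.exp (-(Complex.I * ((κ * H : ℝ) : ℂ) * Φ y)) * u y with hw
  have hwC : ContDiff ℝ 1 w :=
    (Complex.contDiff_exp.comp
      (contDiff_const.mul (Complex.ofRealCLM.contDiff.comp hΦ)).neg).mul huC
  have hnw : ∀ x, ‖w x‖ = ‖u x‖ := by
    intro x
    rw [hw]
    simp [Complex.norm_exp]
  have hnu : ∀ x, ‖u x‖ ^ 2 = χ x ^ 2 * ‖ψ x‖ ^ 2 := by
    intro x
    rw [hu]
    simp [mul_pow]
  set s := Real.sqrt (κ * H) with hs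
  have hs0 : 0 < s := Real.sqrt_pos.2 (by positivity)
  have hs2 : s ^ 2 = κ * H := Real.sq_sqrt (by positivity)
  have hR : 4 * Real.sqrt H = 2 * s * h := by
    rw [hs, hh, Real.sqrt_mul hκ0.le, ← hq]
    field_simp
    ring
  have hDir : DirichletClass (fun y => w (c + s⁻¹ • y)) (4 * Real.sqrt H) := by
    rw [hR]
    refine dirichletClass_comp_scaling hwC hs0 h0 fun x hx => ?_
    simp [hw, hu, hχdef, squareCutoff_eq_zero h0 hx]
  have hlow := hE _ hDir
  rw [hR, Eblk_comp_scaling hwC c _ h hs0, hs2, ← hR, mul_pow, Real.sq_sqrt hH.le,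
    setIntegral_congr_set (openSquare_ae_eq_Icc c h), ← hK] at hlow
  set D : ℝ × ℝ → ℝ := fun x => fderiv ℝ (cutoffFlux χ ψ (1, 0)) x (1, 0) +
    fderiv ℝ (cutoffFlux χ ψ (0, 1)) x (0, 1) with hD
  have hX1 := contDiff_cutoffFlux hχ hψ (1, 0)
  have hX2 := contDiff_cutoffFlux hχ hψ (0, 1)
  have hDc : Continuous D := ((hX1.continuous_fderiv one_ne_zero).clm_apply continuous_const).add
      ((hX2.continuous_fderiv one_ne_zero).clm_apply continuous_const)
  have hD0 : ∫ x in K, D x = 0 := by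
    refine integral_divergence_eq_zero hX1 hX2 c h0 (fun x hx => ?_) (fun x hx => ?_)
    · simp [cutoffFlux, hχdef, squareCutoff_eq_zero h0 (Or.inl hx)]
    · simp [cutoffFlux, hχdef, squareCutoff_eq_zero h0 (Or.inr hx)]
  have hχc := hχ.continuous
  have hψc := hψ'.continuous
  have hwc := hwC.continuous
  have hA0 : Continuous fun x => A0 (x - c) := by unfold A0; fun_prop
  have hMc := continuous_magGradSqA hA0 hwC (κ * H)
  have hpt : ∀ x ∈ K, (1 - (Real.sqrt κ)⁻¹) * H / κ *
        magGradSqA (κ * H) (fun x => A0 (x - c)) w x +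
        κ * H * (-‖w x‖ ^ 2 + 1 / 2 * ‖w x‖ ^ 4) ≤
      H / κ * (D x - κ ^ 2 / 4 * (χ x ^ 2 * ‖ψ x‖ ^ 4) + (2 + 16 * C₁ ^ 4) * κ) := by
    intro x hx
    have hχx := squareCutoff_mem_Icc h0 hx
    have hM := magGradSqA_cutoff_mul_eq hχ hψ (hGL x hx)
    have hN : magGradSqA (κ * H) (fun x => A0 (x - c)) w x ≤ _ :=
      magGradSqA_gauge_le hΦ huC A (fun x => A0 (x - c)) (κ * H) (inv_pos.2 hq0) x
    have hg := fderiv_squareCutoff_sq_le h0 hx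
    have hh2 : 8 / h ^ 2 = 2 * q ^ 2 := by
      rw [hh, ← hq]
      field_simp
      norm_num
    rw [hh2] at hg
    have hr := (hΦK x hx)
    have hr' : (fderiv ℝ Φ x (1, 0) - ((A x).1 - (A0 (x - c)).1)) ^ 2 +
          (fderiv ℝ Φ x (0, 1) - ((A x).2 - (A0 (x - c)).2)) ^ 2 ≤ 4 * C₁ ^ 2 / q ^ 6 := by
      rw [hr.1, sub_self, zero_pow two_ne_zero, zero_add, ← sq_abs]
      calc _ ≤ (h * (C₁ / κ)) ^ 2 := by gcongr; exact hr.2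
        _ = _ := by
          rw [hh, ← hq, hqκ]
          field_simp
          ring
    have e4 : ∀ z : ℂ, ‖z‖ ^ 4 = (‖z‖ ^ 2) ^ 2 := fun z => by ring
    have hM0 : 0 ≤ magGradSqA (κ * H) A u x := by unfold magGradSqA; positivity
    rw [hnu] at hN
    rw [e4 (ψ x)] at hM
    rw [hnw, e4 (u x), e4 (ψ x), hnu, ← hq]
    clear_value w
    rw [hqκ] at hM hN hM0 hHκ ⊢
    exact energy_density_algebra hq1 hH hHκ hχx.1 hχx.2 (by positivity)
      (pow_le_one₀ (norm_nonneg _) (hψ1 x hx)) (by positivity) hr' hg hM0 hM hN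
  have hint : ∀ f : ℝ × ℝ → ℝ, Continuous f → IntegrableOn f K := fun f hf =>
    hf.continuousOn.integrableOn_compact hKc
  have hmono := setIntegral_mono_on (hint _ (by fun_prop)) (hint _ (by fun_prop))
    measurableSet_Icc hpt
  have hvol : volume.real K = 16 / κ := by
    rw [hK, Set.Icc_prod_eq, measureReal_def, Measure.volume_eq_prod, Measure.prod_prod,
      ENNReal.toReal_mul, Real.volume_Icc, Real.volume_Icc,
      ENNReal.toReal_ofReal (by simp; linarith),
      ENNReal.toReal_ofReal (by simp; linarith), hh, ← hq, hqκ]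
    field_simp
    ring
  set J := ∫ x in K, χ x ^ 2 * ‖ψ x‖ ^ 4 with hJ
  have hrhs : ∫ x in K, H / κ * (D x - κ ^ 2 / 4 * (χ x ^ 2 * ‖ψ x‖ ^ 4) +
      (2 + 16 * C₁ ^ 4) * κ) =
      H / κ * (0 - κ ^ 2 / 4 * J + 16 / κ * ((2 + 16 * C₁ ^ 4) * κ)) := by
    rw [integral_const_mul, integral_add (hint _ (by fun_prop)) (hint _ (by fun_prop)),
      integral_sub (hint _ hDc) (hint _ (by fun_prop)), hD0, integral_const_mul,
      setIntegral_const, hvol, smul_eq_mul]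
  rw [hrhs] at hmono
  have hQK : openSquare c (Real.sqrt κ)⁻¹ ⊆ K := by
    rintro x ⟨⟨a1, a2⟩, ⟨a3, a4⟩⟩
    have hle : (Real.sqrt κ)⁻¹ ≤ h := by rw [hh]; linarith [inv_pos.2 (Real.sqrt_pos.2 hκ0)]
    exact ⟨⟨by simp; linarith, by simp; linarith⟩, ⟨by simp; linarith, by simp; linarith⟩⟩
  have hJlow : (9 / 16) ^ 2 * ∫ x in openSquare c (Real.sqrt κ)⁻¹, ‖ψ x‖ ^ 4 ≤ J := by
    have hme : MeasurableSet (openSquare c (Real.sqrt κ)⁻¹) :=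
      measurableSet_Ioo.prod measurableSet_Ioo
    rw [← integral_const_mul]
    calc _ ≤ ∫ x in openSquare c (Real.sqrt κ)⁻¹, χ x ^ 2 * ‖ψ x‖ ^ 4 := by
          refine setIntegral_mono_on ((hint _ (by fun_prop)).mono_set hQK)
            ((hint _ (by fun_prop)).mono_set hQK) hme fun x hx => ?_
          have := squareCutoff_ge (c := c) h0 (x := x) (by
            rwa [hh, mul_div_cancel_left₀ _ two_ne_zero])
          gcongr
      _ ≤ J := setIntegral_mono_set (hint _ (by fun_prop))
          (Eventually.of_forall fun x => by positivity) hQK.eventuallyLE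
  have hfin := hlow.le.trans hmono
  have e1 : (4 : ℝ) ^ 2 * H * E = H / κ * (16 * κ * E) := by field_simp; ring
  have e2 : 16 / κ * ((2 + 16 * C₁ ^ 4) * κ) = 16 * (2 + 16 * C₁ ^ 4) := by field_simp
  rw [e1, e2, mul_le_mul_iff_right₀ (by positivity)] at hfin
  have : κ ^ 2 / 4 * ((9 / 16) ^ 2 * ∫ x in openSquare c (Real.sqrt κ)⁻¹, ‖ψ x‖ ^ 4) ≤
      κ ^ 2 / 4 * J := by gcongr
  linarith

/-- Theorem 4.1: Almog's `L⁴`-bound in two dimensions. For a critical point `ψ` of the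
Ginzburg–Landau functional, with `Λκ ≤ H ≤ κ`, `b = (1 − κ^{−1/2})H/κ`, `R = 4√H`,
the a priori bounds `|ψ| ≤ 1` and `|curl A − 1| ≤ C₁/κ`, a lower bound `E < 0` for the
Dirichlet bulk energy satisfying `|E| ≤ C₂(1 − b)²`, one has, on every square `Q` of
side-length `2κ^{−1/2}` well inside `Ω`,
`(1/|Q|)∫_Q |ψ|⁴ ≤ C/κ + C(H/κ − 1)²`, where `|Q| = 4/κ`. -/
theorem almog_L4_bound (Λ C₁ C₂ : ℝ) (hΛ0 : 0 < Λ) (hΛ1 : Λ < 1) (hC₁ : 0 < C₁)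
    (hC₂ : 0 < C₂) :
    ∃ C : ℝ, 0 < C ∧ ∃ κ₀ : ℝ, 0 < κ₀ ∧
    ∀ (κ H : ℝ) (Ω : Set (ℝ × ℝ)) (A : ℝ × ℝ → ℝ × ℝ) (ψ : ℝ × ℝ → ℂ) (E : ℝ),
      κ₀ ≤ κ → Λ * κ ≤ H → H ≤ κ → IsOpen Ω →
      ContDiffOn ℝ 2 A Ω →
      (∀ x ∈ Ω, |curlA A x - 1| ≤ C₁ / κ) →
      ContDiffOn ℝ 2 ψ Ω →
      GLequation κ H A ψ Ω →
      (∀ x ∈ Ω, ‖ψ x‖ ≤ 1) →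
      E < 0 →
      (∀ v : ℝ × ℝ → ℂ, DirichletClass v (4 * Real.sqrt H) →
        Eblk v ((1 - (Real.sqrt κ)⁻¹) * H / κ) (4 * Real.sqrt H)
          ≥ (4 * Real.sqrt H) ^ 2 * E) →
      |E| ≤ C₂ * (1 - (1 - (Real.sqrt κ)⁻¹) * H / κ) ^ 2 →
      ∀ xc : ℝ × ℝ, closedDisk xc (4 * (Real.sqrt κ)⁻¹) ⊆ Ω →
        (κ / 4) * (∫ x in openSquare xc (Real.sqrt κ)⁻¹, ‖ψ x‖ ^ 4)
          ≤ C / κ + C * (H / κ - 1) ^ 2 := by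
  obtain ⟨C₃, hC₃⟩ : ∃ C₃, C₃ = 2 + 16 * C₁ ^ 4 := ⟨_, rfl⟩
  have hC₃0 : 0 < C₃ := by rw [hC₃]; positivity
  refine ⟨64 * C₃ + 128 * C₂, by positivity, 1, one_pos, ?_⟩
  intro κ H Ω A ψ E hκ hΛH hHκ hΩ hA hcurl hψ hGL hψ1 hE0 hE hEb xc hdisk
  have hκ0 : 0 < κ := by linarith
  have hH : 0 < H := (mul_pos hΛ0 hκ0).trans_le hΛH
  obtain ⟨h, hh⟩ : ∃ h, h = 2 * (Real.sqrt κ)⁻¹ := ⟨_, rfl⟩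
  set K := Set.Icc (xc.1 - h, xc.2 - h) (xc.1 + h, xc.2 + h) with hK
  have hKΩ : K ⊆ Ω := by
    refine fun x hx => hdisk ?_
    have h1 : (x.1 - xc.1) ^ 2 ≤ h ^ 2 :=
      sq_le_sq' (by linarith [hx.1.1]) (by linarith [hx.2.1])
    have h2 : (x.2 - xc.2) ^ 2 ≤ h ^ 2 :=
      sq_le_sq' (by linarith [hx.1.2]) (by linarith [hx.2.2])
    have h3 : (4 * (Real.sqrt κ)⁻¹) ^ 2 = 4 * h ^ 2 := by rw [hh]; ring
    change (x.1 - xc.1) ^ 2 + (x.2 - xc.2) ^ 2 ≤ (4 * (Real.sqrt κ)⁻¹) ^ 2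
    rw [h3]
    linarith [sq_nonneg h]
  obtain ⟨A', hA', hAA'⟩ := exists_contDiff_eventuallyEq_of_contDiffOn (n := 2) hΩ
    (isClosed_Icc : IsClosed K) hKΩ hA
  obtain ⟨ψ', hψ', hψψ'⟩ := exists_contDiff_eventuallyEq_of_contDiffOn (n := 2) hΩ
    (isClosed_Icc : IsClosed K) hKΩ hψ
  have hA1 : ∀ x ∈ K, fderiv ℝ (fun y => (A' y).1) x = fderiv ℝ (fun y => (A y).1) x :=
    fun x hx => ((hAA' x hx).fun_comp Prod.fst).fderiv_eq
  have hA2 : ∀ x ∈ K, fderiv ℝ (fun y => (A' y).2) x = fderiv ℝ (fun y => (A y).2) x :=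
    fun x hx => ((hAA' x hx).fun_comp Prod.snd).fderiv_eq
  have hcurl' : ∀ x ∈ K, |curlA A' x - 1| ≤ C₁ / κ := by
    intro x hx
    have := hcurl x (hKΩ hx)
    rwa [curlA, hA1 x hx, hA2 x hx]
  have hGL' : GLequation κ H A' ψ' K := by
    intro x hx
    have hd2 : ∀ e, fderiv ℝ (fun y => fderiv ℝ ψ' y e) x =
        fderiv ℝ (fun y => fderiv ℝ ψ y e) x := fun e =>
      ((hψψ' x hx).fderiv.fun_comp fun L => L e).fderiv_eq
    have := hGL x (hKΩ hx)
    rwa [magLapA, lap, divA, hd2, hd2, hA1 x hx, hA2 x hx, (hAA' x hx).eq_of_nhds,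
      (hψψ' x hx).fderiv_eq, (hψψ' x hx).eq_of_nhds]
  have hψ1' : ∀ x ∈ K, ‖ψ' x‖ ≤ 1 := fun x hx => by
    rw [(hψψ' x hx).eq_of_nhds]
    exact hψ1 x (hKΩ hx)
  have key := integral_norm_pow_four_le hκ hH hHκ hC₁ hA' hψ' hh hcurl' hGL' hψ1' hE
  have hQ : ∫ x in openSquare xc (Real.sqrt κ)⁻¹, ‖ψ' x‖ ^ 4 =
      ∫ x in openSquare xc (Real.sqrt κ)⁻¹, ‖ψ x‖ ^ 4 := by
    refine setIntegral_congr_fun (measurableSet_Ioo.prod measurableSet_Ioo) fun x hx => ?_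
    obtain ⟨⟨a1, a2⟩, ⟨a3, a4⟩⟩ := hx
    have hle : (Real.sqrt κ)⁻¹ ≤ h := by rw [hh]; linarith [inv_pos.2 (Real.sqrt_pos.2 hκ0)]
    have hxK : x ∈ K :=
      ⟨⟨by simp; linarith, by simp; linarith⟩, ⟨by simp; linarith, by simp; linarith⟩⟩
    simp only [(hψψ' x hxK).eq_of_nhds]
  rw [hQ, ← hC₃] at key
  set J := ∫ x in openSquare xc (Real.sqrt κ)⁻¹, ‖ψ x‖ ^ 4
  rw [abs_of_neg hE0] at hEb
  have hb : (1 - (1 - (Real.sqrt κ)⁻¹) * H / κ) ^ 2 ≤ 2 * (H / κ - 1) ^ 2 + 2 * (1 / κ) := by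
    have hr : (H / κ) ^ 2 ≤ 1 := pow_le_one₀ (by positivity) ((div_le_one hκ0).2 hHκ)
    have hq : (Real.sqrt κ)⁻¹ ^ 2 = 1 / κ := by rw [inv_pow, Real.sq_sqrt hκ0.le, one_div]
    have h1 : (1 - (1 - (Real.sqrt κ)⁻¹) * H / κ) ^ 2 =
        ((H / κ - 1) - (Real.sqrt κ)⁻¹ * (H / κ)) ^ 2 := by ring
    have h2 : (Real.sqrt κ)⁻¹ ^ 2 * (H / κ) ^ 2 ≤ 1 / κ := by
      rw [hq]
      exact mul_le_of_le_one_right (by positivity) hr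
    rw [h1]
    linarith [sq_nonneg ((H / κ - 1) + (Real.sqrt κ)⁻¹ * (H / κ))]
  have hE' : -E ≤ C₂ * (2 * (H / κ - 1) ^ 2 + 2 * (1 / κ)) :=
    hEb.trans (mul_le_mul_of_nonneg_left hb hC₂.le)
  have key' : 81 / 256 * (κ / 4 * J) ≤ 16 * C₃ * (1 / κ) + 16 * -E := by
    have : κ * (81 / 256 * (κ / 4 * J)) ≤ κ * (16 * C₃ * (1 / κ) + 16 * -E) := by
      have e : κ * (16 * C₃ * (1 / κ) + 16 * -E) = 16 * C₃ - 16 * κ * E := by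
        field_simp
        ring
      rw [e]
      linarith
    exact le_of_mul_le_mul_left this hκ0
  have p1 : 0 ≤ C₃ * (1 / κ) := by positivity
  have p2 : 0 ≤ C₂ * (1 / κ) := by positivity
  have p3 : 0 ≤ C₂ * (H / κ - 1) ^ 2 := by positivity
  have p4 : 0 ≤ C₃ * (H / κ - 1) ^ 2 := by positivity
  rw [div_eq_mul_one_div _ κ]
  linarith
end
end
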